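/- In the matrix Charlier setting with the specific parameters, let (P_n^{(λ)}) be the monic orthogonal sequence of W^{(λ)} and let B_n^{(λ)}, C_n^{(λ)} be its three term recurrence coefficients, i.e. x·P_n^{(λ)}(x) = P_{n+1}^{(λ)}(x) + B_n^{(λ)}P_n^{(λ)}(x) + C_n^{(λ)}P_{n−1}^{(λ)}(x). Let J = diag(1,…,N), let 𝒜_ν = (N+ν−J)^{−1}·J·A^* for integers ν ≥ 1, and let D_n^{(λ)} be the diagonal matrix with (D_n^{(λ)})_{jj} = (−1)^j·e^a·n!·a^n·(a/2)^λ·((λ+N−j)!/(j−1)!)·(−N−λ−n)_j/(λ+n+1)_{N−j+1}. Then for every λ ∈ ℕ₀ and every n ≥ 1: C_n^{(λ)} = L_0^{−1}·(I+A)^{n+λ}·D_n^{(λ)}·(I+A^*)·(D_{n−1}^{(λ)})^{−1}·(I+A)^{−(n+λ−1)}·L_0, and B_n^{(λ)} = a·L_0^{−1}·(I+A)^{n+λ}·( (n+1)(I+A)𝒜_{n+λ+1} − n·𝒜_{n+λ}(I+A) + (I+A) + (n/a)·I )·(I+A)^{−(n+λ)}·L_0. -/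

import Mathlib

open scoped BigOperators ComplexOrder
open Matrix Polynomial

noncomputable section

/-- The space of `N × N` complex matrices, with rows and columns indexed by `Fin N`
(the index `j : Fin N` corresponds to the row/column `j+1 ∈ {1,…,N}` of the paper). -/
abbrev Mat (N : ℕ) := Matrix (Fin N) (Fin N) ℂ

/-- Evaluation of a matrix polynomial at a (scalar) complex number. -/
def matEval {N : ℕ} (P : Polynomial (Mat N)) (z : ℂ) : Mat N :=
  P.eval (z • (1 : Mat N))

/-- The scalar Charlier polynomial
`c_n^{(a)}(x) = ∑_{k=0}^n ((-n)_k (-x)_k / k!) (-1/a)^k`. -/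
def charlier (a : ℂ) (n : ℕ) (x : ℂ) : ℂ :=
  ∑ k ∈ Finset.range (n + 1),
    (ascPochhammer ℂ k).eval (-(n : ℂ)) * (ascPochhammer ℂ k).eval (-x)
      / (k.factorial : ℂ) * (-(1 / a)) ^ k

/-- The nilpotent matrix `A` with `A_{j+1,j} = μ_{j+1}/μ_j` (paper indices `1,…,N`). -/
def Amat (N : ℕ) (μ : ℕ → ℝ) : Mat N :=
  Matrix.of fun j k : Fin N =>
    if (j : ℕ) = (k : ℕ) + 1 then ((μ ((j : ℕ) + 1) / μ ((k : ℕ) + 1) : ℝ) : ℂ) else 0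

/-- The diagonal matrix `T = diag(δ_1,…,δ_N)`. -/
def Tmat (N : ℕ) (δ : ℕ → ℝ) : Mat N :=
  Matrix.diagonal fun k : Fin N => ((δ ((k : ℕ) + 1) : ℝ) : ℂ)

/-- The matrix Charlier weight
`W^{(λ)}(x) = (a^x/x!) (I+A)^{x+λ} T^{(λ)} (I+A^*)^{x+λ}`. -/
def Wch (N : ℕ) (a : ℝ) (μ δ : ℕ → ℝ) (lam x : ℕ) : Mat N :=
  ((a ^ x / x.factorial : ℝ) : ℂ) •
    ((1 + Amat N μ) ^ (x + lam) * Tmat N δ * (1 + (Amat N μ)ᴴ) ^ (x + lam))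

/-- The unipotent lower triangular matrix `L(x)` with entries
`L(x)_{j,k} = (μ_j/μ_k)(-a)^{j-k} c_{j-k}^{(a)}(x)/(j-k)!` for `j ≥ k`. -/
def Lmat (N : ℕ) (a : ℝ) (μ : ℕ → ℝ) (z : ℂ) : Mat N :=
  Matrix.of fun j k : Fin N =>
    if (k : ℕ) ≤ (j : ℕ) then
      ((μ ((j : ℕ) + 1) / μ ((k : ℕ) + 1) : ℝ) : ℂ) * (-(a : ℂ)) ^ ((j : ℕ) - (k : ℕ))
        * charlier (a : ℂ) ((j : ℕ) - (k : ℕ)) z / ((((j : ℕ) - (k : ℕ)).factorial) : ℂ)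
    else 0

/-- Matrix-valued inner product for a weight supported on `ℕ₀`. -/
def innerN {N : ℕ} (W : ℕ → Mat N) (P Q : Polynomial (Mat N)) : Mat N :=
  ∑' x : ℕ, matEval P x * W x * (matEval Q x)ᴴ

/-- `P` is the monic orthogonal sequence of the weight `W` supported on `ℕ₀`. -/
structure IsMOSN {N : ℕ} (W : ℕ → Mat N) (P : ℕ → Polynomial (Mat N)) : Prop where
  monic : ∀ n, (P n).Monic
  deg : ∀ n, (P n).natDegree = n
  orth : ∀ m n, m ≠ n → innerN W (P m) (P n) = 0

/-- The diagonal matrix `J = diag(1,2,…,N)`. -/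
def Jdiag (N : ℕ) : Mat N := Matrix.diagonal fun j : Fin N => ((j : ℕ) + 1 : ℂ)

/-- The specific parameters `μ_j = a^{-j/2}/√((N-j)!)`. -/
def μch (N : ℕ) (a : ℝ) (j : ℕ) : ℝ :=
  (Real.sqrt a ^ j * Real.sqrt ((N - j).factorial))⁻¹

/-- The specific parameters `δ_k^{(λ)} = (a/2)^λ (λ+k-1)!/(k-1)!`. -/
def δch (a : ℝ) (lam k : ℕ) : ℝ :=
  (a / 2) ^ lam * ((lam + k - 1).factorial : ℝ) / ((k - 1).factorial : ℝ)

/-- The diagonal matrix `D_n^{(λ)}` with entries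
`(-1)^j e^a n! a^n (a/2)^λ ((λ+N-j)!/(j-1)!) (-N-λ-n)_j/(λ+n+1)_{N-j+1}`
(paper index `j ∈ {1,…,N}`). -/
def Dch (N : ℕ) (a : ℝ) (n lam : ℕ) : Mat N :=
  Matrix.diagonal fun j : Fin N =>
    (-1 : ℂ) ^ ((j : ℕ) + 1) * Complex.exp (a : ℂ) * (n.factorial : ℂ) * (a : ℂ) ^ n
      * ((a : ℂ) / 2) ^ lam * (((lam + (N - ((j : ℕ) + 1))).factorial) : ℂ)
      / (((j : ℕ).factorial) : ℂ)
      * (ascPochhammer ℂ ((j : ℕ) + 1)).eval (-((N : ℂ) + (lam : ℂ) + (n : ℂ)))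
      / (ascPochhammer ℂ (N - (j : ℕ))).eval ((lam : ℂ) + (n : ℂ) + 1)

/-- The matrix `𝒜_ν = (N+ν-J)⁻¹ J A^*`. -/
def Acal (N : ℕ) (a : ℝ) (ν : ℕ) : Mat N :=
  (((N : ℂ) + (ν : ℂ)) • (1 : Mat N) - Jdiag N)⁻¹ * (Jdiag N * (Amat N (μch N a))ᴴ)

/-- Matrix-valued polynomial functions of degree less than `n`. -/
def degLT (N n : ℕ) : Submodule ℂ (ℂ → Mat N) where
  carrier := {f | ∃ c : ℕ → Mat N, ∀ z, f z = ∑ i ∈ Finset.range n, z ^ i • c i}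
  add_mem' := by
    rintro f g ⟨c, hc⟩ ⟨d, hd⟩
    exact ⟨c + d, fun z => by simp [hc, hd, Finset.sum_add_distrib]⟩
  zero_mem' := ⟨0, fun z => by simp⟩
  smul_mem' := by
    rintro r f ⟨c, hc⟩
    exact ⟨r • c, fun z => by simp [hc, Finset.smul_sum, smul_comm r]⟩

section DegLT

variable {N : ℕ}

theorem degLT_mono {m n : ℕ} (h : m ≤ n) : degLT N m ≤ degLT N n := by
  rintro f ⟨c, hc⟩
  refine ⟨fun i => if i < m then c i else 0, fun z => ?_⟩
  rw [hc, ← Finset.sum_subset (Finset.range_mono h)]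
  · exact Finset.sum_congr rfl fun i hi => by simp [Finset.mem_range.1 hi]
  · intro i _ hi
    simp [Finset.mem_range] at hi
    simp [not_lt.2 hi]

theorem monomial_mem_degLT (k : ℕ) (c : Mat N) : (fun z => z ^ k • c) ∈ degLT N (k + 1) :=
  ⟨fun i => if i = k then c else 0, fun z => by simp⟩

theorem const_mem_degLT (c : Mat N) : (fun _ => c) ∈ degLT N 1 := by
  simpa using monomial_mem_degLT 0 c

theorem exists_of_mem_degLT_succ {n : ℕ} {f : ℂ → Mat N} (hf : f ∈ degLT N (n + 1)) :
    ∃ c : Mat N, (f - fun z => z ^ n • c) ∈ degLT N n := by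
  obtain ⟨c, hc⟩ := hf
  exact ⟨c n, c, fun z => by simp [hc, Finset.sum_range_succ]⟩

theorem mul_const_mem_degLT {n : ℕ} {f : ℂ → Mat N} (hf : f ∈ degLT N n) (M : Mat N) :
    (fun z => f z * M) ∈ degLT N n := by
  obtain ⟨c, hc⟩ := hf
  exact ⟨fun i => c i * M, fun z => by simp [hc, Finset.sum_mul]⟩

theorem const_mul_mem_degLT {n : ℕ} {f : ℂ → Mat N} (hf : f ∈ degLT N n) (M : Mat N) :
    (fun z => M * f z) ∈ degLT N n := by
  obtain ⟨c, hc⟩ := hf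
  exact ⟨fun i => M * c i, fun z => by simp [hc, Finset.mul_sum]⟩

theorem smul_mem_degLT {n : ℕ} {f : ℂ → Mat N} (hf : f ∈ degLT N n) :
    (fun z => z • f z) ∈ degLT N (n + 1) := by
  obtain ⟨c, hc⟩ := hf
  refine ⟨fun i => c (i - 1) * (if i = 0 then 0 else 1), fun z => ?_⟩
  simp [hc, Finset.sum_range_succ', Finset.smul_sum, smul_smul, pow_succ']

theorem monomial_shift_mem_degLT (n : ℕ) (s : ℂ) (c : Mat N) :
    (fun z => (z + s) ^ n • c) ∈ degLT N (n + 1) := by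
  refine ⟨fun i => (s ^ (n - i) * (n.choose i : ℂ)) • c, fun z => ?_⟩
  simp [add_pow, Finset.sum_smul, smul_smul, mul_assoc]

theorem shift_mem_degLT {n : ℕ} {f : ℂ → Mat N} (hf : f ∈ degLT N n) (s : ℂ) :
    (fun z => f (z + s)) ∈ degLT N n := by
  obtain ⟨c, hc⟩ := hf
  have : (fun z => f (z + s)) = ∑ i ∈ Finset.range n, fun z => (z + s) ^ i • c i := by
    ext1 z
    simp [hc]
  rw [this]
  exact Submodule.sum_mem _ fun i hi =>
    degLT_mono (Finset.mem_range.1 hi) (monomial_shift_mem_degLT i s (c i))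

theorem monomial_difference_mem_degLT (n : ℕ) (s : ℂ) (c : Mat N) :
    (fun z => (z + s) ^ n • c - z ^ n • c) ∈ degLT N n := by
  refine ⟨fun i => (s ^ (n - i) * (n.choose i : ℂ)) • c, fun z => ?_⟩
  simp [add_pow, Finset.sum_range_succ, add_smul, Finset.sum_smul, smul_smul, mul_assoc]

theorem monomial_difference_sub_mem_degLT (n : ℕ) (s : ℂ) (c : Mat N) :
    (fun z => (z + s) ^ (n + 1) • c - z ^ (n + 1) • c - z ^ n • (((n : ℂ) + 1) * s) • c)
      ∈ degLT N n := by
  refine ⟨fun i => (s ^ (n + 1 - i) * ((n + 1).choose i : ℂ)) • c, fun z => ?_⟩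
  simp [add_pow, Finset.sum_range_succ, add_smul, Finset.sum_smul, smul_smul, mul_assoc,
    mul_comm s]

theorem monomial_difference_sub_sub_mem_degLT (n : ℕ) (c : Mat N) :
    (fun z => (z + 1) ^ (n + 2) • c - z ^ (n + 2) • c - z ^ (n + 1) • ((n : ℂ) + 2) • c
      - z ^ n • (((n : ℂ) + 2) * (n + 1) / 2) • c) ∈ degLT N n := by
  refine ⟨fun i => ((n + 2).choose i : ℂ) • c, fun z => ?_⟩
  have h : ((n + 2).choose n : ℂ) = ((n : ℂ) + 2) * (n + 1) / 2 := by
    rw [Nat.choose_symm_add, Nat.cast_choose_two]; push_cast; ring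
  simp [add_pow, Finset.sum_range_succ, add_smul, Finset.sum_smul, smul_smul, h]
  module

theorem difference_mem_degLT {n : ℕ} {f : ℂ → Mat N} (hf : f ∈ degLT N (n + 1)) (s : ℂ) :
    (fun z => f (z + s) - f z) ∈ degLT N n := by
  obtain ⟨c, hc⟩ := hf
  have : (fun z => f (z + s) - f z)
      = ∑ i ∈ Finset.range (n + 1), fun z => ((z + s) ^ i • c i - z ^ i • c i) := by
    ext1 z
    simp [hc]
  rw [this]
  exact Submodule.sum_mem _ fun i hi => degLT_mono (Nat.lt_succ_iff.1 (Finset.mem_range.1 hi))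
    (monomial_difference_mem_degLT i s (c i))

theorem matEval_eq_sum (p : Polynomial (Mat N)) (z : ℂ) :
    matEval p z = ∑ i ∈ Finset.range (p.natDegree + 1), z ^ i • p.coeff i := by
  rw [matEval, Polynomial.eval_eq_sum_range]
  simp [_root_.smul_pow]

theorem matEval_sub_mem_degLT {p : Polynomial (Mat N)} {n : ℕ} (hp : p.Monic)
    (hn : p.natDegree = n) : (matEval p - fun z => z ^ n • (1 : Mat N)) ∈ degLT N n := by
  refine ⟨p.coeff, fun z => ?_⟩
  have := hp.coeff_natDegree
  rw [hn] at this
  simp [matEval_eq_sum, hn, Finset.sum_range_succ, this]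

theorem matEval_sub_sub_mem_degLT {p : Polynomial (Mat N)} {n : ℕ} (hp : p.Monic)
    (hn : p.natDegree = n + 1) :
    (matEval p - (fun z => z ^ (n + 1) • (1 : Mat N)) - fun z => z ^ n • p.coeff n)
      ∈ degLT N n := by
  refine ⟨p.coeff, fun z => ?_⟩
  have := hp.coeff_natDegree
  rw [hn] at this
  simp [matEval_eq_sum, hn, Finset.sum_range_succ, this]

end DegLT

/-- The matrix-valued inner product on functions. -/
def ip {N : ℕ} (W : ℕ → Mat N) (f g : ℂ → Mat N) : Mat N :=
  ∑' x : ℕ, f x * W x * (g x)ᴴ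

/-- A Hermitian weight on `ℕ` with all moments finite. -/
structure IsWeight {N : ℕ} (W : ℕ → Mat N) : Prop where
  herm : ∀ x, (W x)ᴴ = W x
  summable : ∀ {m n : ℕ} {f g : ℂ → Mat N}, f ∈ degLT N m → g ∈ degLT N n →
    Summable fun x : ℕ => f x * W x * (g x)ᴴ

namespace IsWeight

variable {N : ℕ} {W : ℕ → Mat N}

theorem ip_conjTranspose (hW : IsWeight W) (f g : ℂ → Mat N) : (ip W f g)ᴴ = ip W g f := by
  rw [ip, ip, Matrix.conjTranspose_tsum]
  exact tsum_congr fun x => by simp [hW.herm, Matrix.mul_assoc]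

theorem ip_add_left (hW : IsWeight W) {m m' n : ℕ} {f f' g : ℂ → Mat N} (hf : f ∈ degLT N m)
    (hf' : f' ∈ degLT N m') (hg : g ∈ degLT N n) : ip W (f + f') g = ip W f g + ip W f' g := by
  rw [ip, ip, ip, ← (hW.summable hf hg).tsum_add (hW.summable hf' hg)]
  exact tsum_congr fun x => by simp [add_mul]

theorem ip_mul_left (hW : IsWeight W) {m n : ℕ} {f g : ℂ → Mat N} (hf : f ∈ degLT N m)
    (hg : g ∈ degLT N n) (M : Mat N) : ip W (fun z => M * f z) g = M * ip W f g := by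
  rw [ip, ip, ← (hW.summable hf hg).tsum_mul_left]
  exact tsum_congr fun x => by simp [Matrix.mul_assoc]

theorem ip_sub_left (hW : IsWeight W) {m m' n : ℕ} {f f' g : ℂ → Mat N} (hf : f ∈ degLT N m)
    (hf' : f' ∈ degLT N m') (hg : g ∈ degLT N n) : ip W (f - f') g = ip W f g - ip W f' g := by
  rw [ip, ip, ip, ← (hW.summable hf hg).tsum_sub (hW.summable hf' hg)]
  exact tsum_congr fun x => by simp [sub_mul]

end IsWeight

namespace IsMOSN

variable {N : ℕ} {W : ℕ → Mat N} {P : ℕ → Polynomial (Mat N)}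

theorem sub_monomial_mem (hP : IsMOSN W P) (n : ℕ) :
    (matEval (P n) - fun z => z ^ n • (1 : Mat N)) ∈ degLT N n :=
  matEval_sub_mem_degLT (hP.monic n) (hP.deg n)

theorem mem_degLT (hP : IsMOSN W P) (n : ℕ) : matEval (P n) ∈ degLT N (n + 1) := by
  have := add_mem (degLT_mono n.le_succ (hP.sub_monomial_mem n)) (monomial_mem_degLT n (1 : Mat N))
  rwa [sub_add_cancel] at this

theorem ip_eq_zero_of_ne (hP : IsMOSN W P) {m n : ℕ} (h : m ≠ n) :
    ip W (matEval (P m)) (matEval (P n)) = 0 := hP.orth m n h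

theorem sub_mul_mem (hP : IsMOSN W P) {n : ℕ} {f : ℂ → Mat N} {c : Mat N}
    (hf : (f - fun z => z ^ n • c) ∈ degLT N n) :
    (f - fun z => c * matEval (P n) z) ∈ degLT N n := by
  have := sub_mem hf (const_mul_mem_degLT (hP.sub_monomial_mem n) c)
  convert this using 1
  ext1 z
  simp [mul_sub]

theorem ip_eq_zero_of_mem (hP : IsMOSN W P) (hW : IsWeight W) {n : ℕ} (k : ℕ) (hk : k ≤ n)
    {f : ℂ → Mat N} (hf : f ∈ degLT N k) : ip W f (matEval (P n)) = 0 := by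
  induction k generalizing f with
  | zero =>
    obtain ⟨c, hc⟩ := hf
    simp [ip, hc]
  | succ k ih =>
    obtain ⟨c, hc⟩ := exists_of_mem_degLT_succ hf
    have h1 := hP.sub_mul_mem hc
    have h2 := ih (by omega) h1
    rw [hW.ip_sub_left hf (const_mul_mem_degLT (hP.mem_degLT k) c) (hP.mem_degLT n),
      hW.ip_mul_left (hP.mem_degLT k) (hP.mem_degLT n), hP.ip_eq_zero_of_ne (by omega)] at h2
    simpa using h2

theorem ip_eq_zero_of_mem' (hP : IsMOSN W P) (hW : IsWeight W) {n : ℕ}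
    {f : ℂ → Mat N} (hf : f ∈ degLT N n) : ip W (matEval (P n)) f = 0 := by
  rw [← hW.ip_conjTranspose, hP.ip_eq_zero_of_mem hW n le_rfl hf, Matrix.conjTranspose_zero]

theorem ip_of_sub_mem (hP : IsMOSN W P) (hW : IsWeight W) {n : ℕ}
    {f : ℂ → Mat N} {c : Mat N} (hf : (f - fun z => z ^ n • c) ∈ degLT N n) :
    ip W f (matEval (P n)) = c * ip W (matEval (P n)) (matEval (P n)) := by
  have hf' : f ∈ degLT N (n + 1) := by
    have := add_mem (degLT_mono n.le_succ hf) (monomial_mem_degLT n c)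
    rwa [sub_add_cancel] at this
  have h2 := hP.ip_eq_zero_of_mem hW n le_rfl (hP.sub_mul_mem hf)
  rwa [hW.ip_sub_left hf' (const_mul_mem_degLT (hP.mem_degLT n) c) (hP.mem_degLT n),
      hW.ip_mul_left (hP.mem_degLT n) (hP.mem_degLT n), sub_eq_zero] at h2

theorem ip_of_sub_mem' (hP : IsMOSN W P) (hW : IsWeight W) {n : ℕ}
    {f : ℂ → Mat N} {c : Mat N} (hf : (f - fun z => z ^ n • c) ∈ degLT N n) :
    ip W (matEval (P n)) f = ip W (matEval (P n)) (matEval (P n)) * cᴴ := by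
  rw [← hW.ip_conjTranspose, hP.ip_of_sub_mem hW hf, Matrix.conjTranspose_mul,
    hW.ip_conjTranspose]

end IsMOSN

section Commutation

variable {R : Type*} [Ring R] [Algebra ℂ R] {A J F S : R} {b : ℂ}

theorem aeval_mul_of_lowering (h : A * J = J * A - A) (p : ℂ[X]) :
    aeval A p * J = J * aeval A p - A * aeval A (derivative p) := by
  induction p using Polynomial.induction_on with
  | C r => simp [Algebra.commutes]
  | add p q hp hq => simp only [map_add, add_mul, mul_add, hp, hq]; abel
  | monomial n r ih =>
    rw [show C r * X ^ (n + 1) = X * (C r * X ^ n) by ring]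
    set q : ℂ[X] := C r * X ^ n
    simp only [derivative_mul, derivative_X, one_mul, map_mul, map_add, aeval_X]
    rw [mul_assoc, ih, mul_sub, ← mul_assoc, h]
    noncomm_ring

theorem aeval_mul_of_raising (h : A * F = F * A + S) (hS : A * S = S * A - (2 * b) • A)
    (p : ℂ[X]) :
    aeval A p * F = F * aeval A p + S * aeval A (derivative p)
      - b • (A * aeval A (derivative (derivative p))) := by
  induction p using Polynomial.induction_on with
  | C r => simp [Algebra.commutes]
  | add p q hp hq => simp only [map_add, add_mul, mul_add, smul_add, hp, hq]; abel
  | monomial n r ih =>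
    rw [show C r * X ^ (n + 1) = X * (C r * X ^ n) by ring]
    set q : ℂ[X] := C r * X ^ n
    simp only [derivative_mul, derivative_X, one_mul, map_mul, map_add, aeval_X]
    rw [mul_assoc, ih, mul_sub, mul_add, ← mul_assoc, h, ← mul_assoc, hS]
    simp only [sub_mul, add_mul, mul_add, mul_smul_comm, smul_mul_assoc, smul_add, mul_assoc]
    module

end Commutation

section Lowering

variable {N : ℕ} {a : ℝ}

theorem μch_pos (ha : 0 < a) (j : ℕ) : 0 < μch N a j := by
  rw [μch]
  positivity

theorem μch_sq (ha : 0 < a) (j : ℕ) :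
    μch N a j ^ 2 = (a ^ j * ((N - j).factorial : ℝ))⁻¹ := by
  rw [μch, inv_pow, mul_pow, Real.sq_sqrt (by positivity), ← pow_mul, mul_comm j 2, pow_mul,
    Real.sq_sqrt ha.le]

theorem Amat_mul_apply (μ : ℕ → ℝ) (M : Mat N) (j k : Fin N) :
    (Amat N μ * M) j k = if h : 0 < (j : ℕ) then
      ((μ (j + 1) / μ j : ℝ) : ℂ) * M ⟨j - 1, by omega⟩ k else 0 := by
  rw [Matrix.mul_apply]
  split_ifs with h
  · rw [Finset.sum_eq_single ⟨(j : ℕ) - 1, by omega⟩]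
    · simp [Amat, Nat.sub_add_cancel h]
    · intro l _ hl
      rw [Amat, Matrix.of_apply, if_neg, zero_mul]
      rintro h'
      exact hl (Fin.ext (by simp [h']))
    · simp
  · refine Finset.sum_eq_zero fun l _ => ?_
    rw [Amat, Matrix.of_apply, if_neg (by omega), zero_mul]

theorem mul_Amat_apply (μ : ℕ → ℝ) (M : Mat N) (j k : Fin N) :
    (M * Amat N μ) j k = if h : (k : ℕ) + 1 < N then
      M j ⟨k + 1, h⟩ * ((μ (k + 2) / μ (k + 1) : ℝ) : ℂ) else 0 := by
  rw [Matrix.mul_apply]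
  split_ifs with h
  · rw [Finset.sum_eq_single ⟨(k : ℕ) + 1, h⟩]
    · simp [Amat]
    · intro l _ hl
      rw [Amat, Matrix.of_apply, if_neg, mul_zero]
      rintro h'
      exact hl (Fin.ext (by simp [h']))
    · simp
  · refine Finset.sum_eq_zero fun l _ => ?_
    rw [Amat, Matrix.of_apply, if_neg (by omega), mul_zero]

theorem Amat_conjTranspose_apply (μ : ℕ → ℝ) (j k : Fin N) :
    (Amat N μ)ᴴ j k = if (k : ℕ) = j + 1 then ((μ (k + 1) / μ (j + 1) : ℝ) : ℂ) else 0 := by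
  rw [Matrix.conjTranspose_apply, Amat, Matrix.of_apply]
  split_ifs <;> simp

theorem Amat_pow_apply (ha : 0 < a) (m : ℕ) (j k : Fin N) :
    (Amat N (μch N a) ^ m) j k
      = if (j : ℕ) = k + m then ((μch N a (j + 1) / μch N a (k + 1) : ℝ) : ℂ) else 0 := by
  induction m generalizing j k with
  | zero =>
    have := (μch_pos (N := N) ha (k + 1)).ne'
    by_cases h : j = k
    · subst h; simp [this]
    · simp [h, Fin.val_inj]
  | succ m ih =>
    rw [pow_succ, mul_Amat_apply]
    have := (μch_pos (N := N) ha (k + 2)).ne'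
    split_ifs with h h' h'
    · rw [ih, if_pos (by simp; omega), ← Complex.ofReal_mul]
      congr 1
      simp only [add_assoc, Nat.reduceAdd]
      field_simp
    · rw [ih, if_neg (by simp; omega), zero_mul]
    · omega
    · rfl

theorem Amat_pow_card (ha : 0 < a) : Amat N (μch N a) ^ N = 0 := by
  ext j k
  rw [Amat_pow_apply ha, if_neg (by omega)]
  rfl

theorem Jdiag_apply (j k : Fin N) : Jdiag N j k = if j = k then (j : ℂ) + 1 else 0 := by
  rw [Jdiag, Matrix.diagonal_apply]

theorem Amat_mul_Jdiag (μ : ℕ → ℝ) : Amat N μ * Jdiag N = Jdiag N * Amat N μ - Amat N μ := by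
  ext j k
  rw [Matrix.sub_apply, Jdiag, Matrix.mul_diagonal, Matrix.diagonal_mul, Amat, Matrix.of_apply]
  split_ifs with h
  · rw [h]; push_cast; ring
  · simp

/-- The raising operator `J A^*` of the `sl₂`-triple attached to `A`. -/
def Fmat (N : ℕ) (a : ℝ) : Mat N := Jdiag N * (Amat N (μch N a))ᴴ

/-- The semisimple element `[A, J A^*]` of the `sl₂`-triple attached to `A`. -/
def Smat (N : ℕ) (a : ℝ) : Mat N :=
  (1 / (a : ℂ)) • ((2 : ℂ) • Jdiag N - ((N : ℂ) + 1) • (1 : Mat N))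

theorem Fmat_apply (j k : Fin N) : Fmat N a j k = if (k : ℕ) = j + 1 then
    ((j : ℂ) + 1) * ((μch N a (k + 1) / μch N a (j + 1) : ℝ) : ℂ) else 0 := by
  rw [Fmat, Jdiag, Matrix.diagonal_mul, Amat_conjTranspose_apply]
  split_ifs <;> simp

theorem μch_ratio_sq (ha : 0 < a) {l : ℕ} (hl : l + 2 ≤ N) :
    (μch N a (l + 2) / μch N a (l + 1)) ^ 2 = ((N : ℝ) - l - 1) / a := by
  obtain ⟨d, rfl⟩ := Nat.exists_eq_add_of_le hl
  rw [div_pow, μch_sq ha, μch_sq ha, show l + 2 + d - (l + 2) = d by omega,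
    show l + 2 + d - (l + 1) = d + 1 by omega, Nat.factorial_succ]
  have := d.factorial_pos
  push_cast
  field_simp
  ring

theorem Amat_mul_Fmat (ha : 0 < a) :
    Amat N (μch N a) * Fmat N a = Fmat N a * Amat N (μch N a) + Smat N a := by
  have ha' : (a : ℂ) ≠ 0 := by exact_mod_cast ha.ne'
  ext j k
  rw [Matrix.add_apply, Amat_mul_apply, mul_Amat_apply]
  have hr : ∀ l : ℕ, l + 2 ≤ N → ((μch N a (l + 2) / μch N a (l + 1) : ℝ) : ℂ) ^ 2
      = ((N : ℂ) - l - 1) / a := fun l hl => by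
    rw [← Complex.ofReal_pow, μch_ratio_sq ha hl]; push_cast; ring
  have h1 : (if h : 0 < (j : ℕ) then ((μch N a (j + 1) / μch N a j : ℝ) : ℂ)
      * Fmat N a ⟨j - 1, by omega⟩ k else 0) = if j = k then (j : ℂ) * (N - j) / a else 0 := by
    split_ifs with h h' h'
    · subst h'
      obtain ⟨l, hl⟩ := Nat.exists_eq_add_of_lt h
      have h2 := hr l (by omega)
      rw [Fmat_apply, if_pos (by simp; omega)]
      simp only [hl, zero_add, Nat.add_sub_cancel] at h2 ⊢
      rw [show l + 1 + 1 = l + 2 from rfl, mul_left_comm, ← sq, h2]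
      push_cast
      ring
    · rw [Fmat_apply, if_neg, mul_zero]
      simp only
      rw [Nat.sub_add_cancel h]
      exact fun h2 => h' (Fin.ext h2.symm)
    · rw [show (j : ℕ) = 0 by omega]; simp
    · rfl
  have h2 : (if h : (k : ℕ) + 1 < N then Fmat N a j ⟨k + 1, h⟩
      * ((μch N a (k + 2) / μch N a (k + 1) : ℝ) : ℂ) else 0)
      = if j = k then ((j : ℂ) + 1) * (N - j - 1) / a else 0 := by
    split_ifs with h h' h'
    · subst h'
      have h2 := hr j (by omega)
      rw [Fmat_apply, if_pos rfl, mul_assoc]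
      simp only [add_assoc, Nat.reduceAdd]
      rw [← sq, h2]
      ring
    · rw [Fmat_apply, if_neg, zero_mul]
      simp only [Nat.add_right_cancel_iff]
      exact fun h2 => h' (Fin.ext h2.symm)
    · have : (N : ℂ) = (j : ℕ) + 1 := by
        subst h'
        exact_mod_cast (by omega : N = j + 1)
      rw [this]; simp
    · rfl
  rw [h1, h2, Smat]
  simp only [Matrix.smul_apply, Matrix.sub_apply, Jdiag_apply, Matrix.one_apply, smul_eq_mul]
  split_ifs
  · field_simp
    ring
  · simp

theorem Amat_mul_Smat (μ : ℕ → ℝ) :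
    Amat N μ * Smat N a = Smat N a * Amat N μ - (2 * (1 / (a : ℂ))) • Amat N μ := by
  simp only [Smat, mul_smul_comm, smul_mul_assoc, mul_sub, sub_mul, Amat_mul_Jdiag, mul_one,
    one_mul, smul_sub]
  module

theorem isUnit_det_one_add_Amat (μ : ℕ → ℝ) : IsUnit (1 + Amat N μ).det := by
  rw [Matrix.det_of_isLowerTriangular]
  · simp [Amat]
  · intro i j hij
    have hij : (i : ℕ) < j := hij
    rw [Matrix.add_apply, Matrix.one_apply_ne (by rintro rfl; omega), Amat, Matrix.of_apply,
      if_neg (by omega), add_zero]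

/-- The element `A (I+A)⁻¹`. -/
def Umat (N : ℕ) (a : ℝ) : Mat N := Amat N (μch N a) * (1 + Amat N (μch N a))⁻¹

theorem commute_Amat_inv (μ : ℕ → ℝ) : Commute (Amat N μ) (1 + Amat N μ)⁻¹ := by
  have h := isUnit_det_one_add_Amat (N := N) μ
  have h2 : (1 + Amat N μ)⁻¹ * (1 + Amat N μ) = (1 + Amat N μ) * (1 + Amat N μ)⁻¹ := by
    rw [Matrix.nonsing_inv_mul _ h, Matrix.mul_nonsing_inv _ h]
  rw [mul_add, add_mul, mul_one, one_mul] at h2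
  exact (add_left_cancel h2).symm

theorem aeval_derivative_pow (μ : ℕ → ℝ) (y : ℕ) :
    aeval (Amat N μ) (derivative ((1 + X : ℂ[X]) ^ y))
      = (y : ℂ) • ((1 + Amat N μ)⁻¹ * (1 + Amat N μ) ^ y) := by
  have h := isUnit_det_one_add_Amat (N := N) μ
  cases y with
  | zero => simp
  | succ y =>
    rw [pow_succ' (1 + Amat N μ), ← Matrix.mul_assoc, Matrix.nonsing_inv_mul _ h, one_mul,
      derivative_pow]
    simp [Algebra.smul_def]

theorem aeval_derivative_derivative_pow (μ : ℕ → ℝ) (y : ℕ) :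
    aeval (Amat N μ) (derivative (derivative ((1 + X : ℂ[X]) ^ y)))
      = ((y : ℂ) * (y - 1)) •
        ((1 + Amat N μ)⁻¹ * ((1 + Amat N μ)⁻¹ * (1 + Amat N μ) ^ y)) := by
  have h := isUnit_det_one_add_Amat (N := N) μ
  cases y with
  | zero => simp
  | succ y =>
    rw [pow_succ' (1 + Amat N μ), Matrix.nonsing_inv_mul_cancel_left _ _ h, derivative_pow]
    have := aeval_derivative_pow (N := N) μ y
    simp only [Nat.add_sub_cancel, derivative_add, derivative_one, derivative_X, zero_add, mul_one,
      derivative_C_mul, map_mul, this, aeval_C, ← Algebra.smul_def, smul_smul]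
    push_cast
    ring_nf

theorem one_add_pow_mul_Jdiag (a : ℝ) (y : ℕ) :
    (1 + Amat N (μch N a)) ^ y * Jdiag N
      = (Jdiag N - (y : ℂ) • Umat N a) * (1 + Amat N (μch N a)) ^ y := by
  have h := aeval_mul_of_lowering (Amat_mul_Jdiag (N := N) (μch N a)) ((1 + X) ^ y)
  rw [aeval_derivative_pow] at h
  simp only [map_pow, map_add, map_one, aeval_X] at h
  rw [h, Umat, sub_mul, smul_mul_assoc, mul_smul_comm, Matrix.mul_assoc]

theorem one_add_pow_mul_Fmat (ha : 0 < a) (y : ℕ) :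
    (1 + Amat N (μch N a)) ^ y * Fmat N a
      = (Fmat N a + (y : ℂ) • (Smat N a * (1 + Amat N (μch N a))⁻¹)
          - ((1 / (a : ℂ)) * (y * (y - 1))) • (Umat N a * (1 + Amat N (μch N a))⁻¹))
        * (1 + Amat N (μch N a)) ^ y := by
  have h := aeval_mul_of_raising (Amat_mul_Fmat (N := N) ha) (Amat_mul_Smat _) ((1 + X) ^ y)
  rw [aeval_derivative_pow, aeval_derivative_derivative_pow] at h
  simp only [map_pow, map_add, map_one, aeval_X] at h
  rw [h, Umat]
  simp only [sub_mul, add_mul, smul_mul_assoc, mul_smul_comm, Matrix.mul_assoc, smul_smul]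

/-- A truncation of the exponential series of `-a X`. -/
def expTrunc (N : ℕ) (a : ℝ) : ℂ[X] :=
  ∑ m ∈ Finset.range (N + 2), C ((-(a : ℂ)) ^ m / (m.factorial : ℂ)) * X ^ m

theorem derivative_expTrunc (N : ℕ) (a : ℝ) : derivative (expTrunc N a)
    = C (-(a : ℂ)) * expTrunc N a
      - C (-(a : ℂ) * ((-(a : ℂ)) ^ (N + 1) / ((N + 1).factorial : ℂ))) * X ^ (N + 1) := by
  have : derivative (expTrunc N a) = C (-(a : ℂ)) *
      ∑ m ∈ Finset.range (N + 1), C ((-(a : ℂ)) ^ m / (m.factorial : ℂ)) * X ^ m := by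
    rw [expTrunc, derivative_sum, Finset.sum_range_succ', Finset.mul_sum]
    simp only [pow_zero, derivative_C_mul, derivative_one, mul_zero, add_zero]
    refine Finset.sum_congr rfl fun m _ => ?_
    rw [derivative_X_pow, ← mul_assoc, ← mul_assoc, ← C_mul, ← C_mul, Nat.factorial_succ,
      Nat.add_sub_cancel]
    have : (m.factorial : ℂ) ≠ 0 := by exact_mod_cast m.factorial_ne_zero
    have : (m : ℂ) + 1 ≠ 0 := by exact_mod_cast m.succ_ne_zero
    congr 2
    push_cast
    field_simp
    ring
  rw [this, expTrunc, Finset.sum_range_succ _ (N + 1), C_mul]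
  ring

theorem charlier_zero (b : ℂ) (n : ℕ) : charlier b n 0 = 1 := by
  rw [charlier, Finset.sum_range_succ']
  simp

theorem Lmat_zero_eq_aeval (ha : 0 < a) :
    Lmat N a (μch N a) 0 = aeval (Amat N (μch N a)) (expTrunc N a) := by
  ext j k
  rw [expTrunc, map_sum, Matrix.sum_apply, Lmat, Matrix.of_apply]
  simp only [map_mul, aeval_C, map_pow, aeval_X, ← Algebra.smul_def, Matrix.smul_apply,
    Amat_pow_apply ha, charlier_zero, smul_eq_mul, mul_one]
  split_ifs with h
  · rw [Finset.sum_eq_single ((j : ℕ) - k)]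
    · rw [if_pos (by omega)]; ring
    · intro m _ hm
      rw [if_neg (by omega), mul_zero]
    · intro h'
      exact absurd (Finset.mem_range.2 (by omega)) h'
  · refine (Finset.sum_eq_zero fun m _ => ?_).symm
    rw [if_neg (by omega), mul_zero]

theorem isUnit_det_Lmat_zero (ha : 0 < a) : IsUnit (Lmat N a (μch N a) 0).det := by
  rw [Matrix.det_of_isLowerTriangular]
  · simp [Lmat, charlier_zero, (μch_pos (N := N) ha _).ne']
  · intro i j hij
    have hij : (i : ℕ) < j := hij
    rw [Lmat, Matrix.of_apply, if_neg (by omega)]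

theorem aeval_derivative_expTrunc (ha : 0 < a) :
    aeval (Amat N (μch N a)) (derivative (expTrunc N a)) = (-(a : ℂ)) • Lmat N a (μch N a) 0 := by
  rw [derivative_expTrunc, Lmat_zero_eq_aeval ha, Algebra.smul_def]
  simp [pow_succ, Amat_pow_card ha]

theorem aeval_derivative_derivative_expTrunc (ha : 0 < a) :
    aeval (Amat N (μch N a)) (derivative (derivative (expTrunc N a)))
      = ((a : ℂ) ^ 2) • Lmat N a (μch N a) 0 := by
  rw [derivative_expTrunc, derivative_sub, derivative_C_mul, derivative_C_mul, map_sub, map_mul,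
    aeval_derivative_expTrunc ha, aeval_C, ← Algebra.smul_def, smul_smul]
  simp [Amat_pow_card ha, sq]

theorem commute_Lmat_Amat (ha : 0 < a) :
    Commute (Lmat N a (μch N a) 0) (Amat N (μch N a)) := by
  rw [Lmat_zero_eq_aeval ha]
  simpa using Commute.map (Commute.all (expTrunc N a) X) (aeval (Amat N (μch N a)))

theorem Lmat_mul_Jdiag (ha : 0 < a) : Lmat N a (μch N a) 0 * Jdiag N
    = (Jdiag N + (a : ℂ) • Amat N (μch N a)) * Lmat N a (μch N a) 0 := by
  have h := aeval_mul_of_lowering (Amat_mul_Jdiag (N := N) (μch N a)) (expTrunc N a)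
  rw [aeval_derivative_expTrunc ha, ← Lmat_zero_eq_aeval ha] at h
  rw [h, mul_smul_comm, add_mul, smul_mul_assoc]
  module

theorem Lmat_mul_Fmat (ha : 0 < a) : Lmat N a (μch N a) 0 * Fmat N a
    = (Fmat N a - (a : ℂ) • Smat N a - (a : ℂ) • Amat N (μch N a)) * Lmat N a (μch N a) 0 := by
  have ha' : (a : ℂ) ≠ 0 := by exact_mod_cast ha.ne'
  have h := aeval_mul_of_raising (Amat_mul_Fmat (N := N) ha) (Amat_mul_Smat _) (expTrunc N a)
  rw [aeval_derivative_expTrunc ha, aeval_derivative_derivative_expTrunc ha,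
    ← Lmat_zero_eq_aeval ha] at h
  rw [h]
  simp only [mul_smul_comm, sub_mul, smul_mul_assoc, smul_smul]
  rw [show 1 / (a : ℂ) * (a : ℂ) ^ 2 = a by field_simp]
  module

end Lowering

section Growth

attribute [local instance] Matrix.linftyOpNormedRing Matrix.linftyOpNormedAlgebra

variable {N : ℕ}

/-- A sequence of matrices of at most geometric growth. -/
def GeomGrowth (f : ℕ → Mat N) : Prop :=
  ∃ c r : ℝ, 0 ≤ c ∧ 0 ≤ r ∧ ∀ x, ‖f x‖ ≤ c * r ^ x

theorem GeomGrowth.mul {f g : ℕ → Mat N} (hf : GeomGrowth f) (hg : GeomGrowth g) :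
    GeomGrowth fun x => f x * g x := by
  obtain ⟨c, r, hc, hr, h⟩ := hf
  obtain ⟨d, s, hd, hs, h'⟩ := hg
  refine ⟨c * d, r * s, by positivity, by positivity, fun x => (norm_mul_le _ _).trans ?_⟩
  calc ‖f x‖ * ‖g x‖ ≤ (c * r ^ x) * (d * s ^ x) :=
        mul_le_mul (h x) (h' x) (norm_nonneg _) (by positivity)
    _ = c * d * (r * s) ^ x := by ring

theorem geomGrowth_const (M : Mat N) : GeomGrowth fun _ => M :=
  ⟨‖M‖, 1, norm_nonneg _, zero_le_one, by simp⟩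

theorem geomGrowth_pow (M : Mat N) : GeomGrowth fun x => M ^ x := by
  refine ⟨max 1 ‖(1 : Mat N)‖, ‖M‖, by positivity, norm_nonneg _, fun x => ?_⟩
  induction x with
  | zero => simp
  | succ x ih =>
    simp only [pow_succ]
    rw [← mul_assoc]
    exact (norm_mul_le _ _).trans (mul_le_mul_of_nonneg_right ih (norm_nonneg _))

theorem geomGrowth_of_mem_degLT {n : ℕ} {f : ℂ → Mat N} (hf : f ∈ degLT N n) :
    GeomGrowth fun x : ℕ => f x := by
  obtain ⟨c, hc⟩ := hf
  refine ⟨∑ i ∈ Finset.range n, ‖c i‖, 2 ^ n, Finset.sum_nonneg fun _ _ => norm_nonneg _,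
    by positivity, fun x => ?_⟩
  simp only [hc, Finset.sum_mul]
  refine (norm_sum_le _ _).trans (Finset.sum_le_sum fun i hi => ?_)
  rw [norm_smul, mul_comm, norm_pow, Complex.norm_natCast, ← pow_mul, mul_comm n, pow_mul]
  refine mul_le_mul_of_nonneg_left ?_ (norm_nonneg _)
  calc (x : ℝ) ^ i ≤ (2 ^ x) ^ i := by
        gcongr
        exact_mod_cast x.lt_two_pow_self.le
    _ ≤ (2 ^ x) ^ n :=
        pow_le_pow_right₀ (one_le_pow₀ one_le_two) (Finset.mem_range.1 hi).le

theorem exists_conjTranspose_mem_degLT {n : ℕ} {f : ℂ → Mat N} (hf : f ∈ degLT N n) :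
    ∃ g ∈ degLT N n, ∀ x : ℕ, (f x)ᴴ = g x := by
  obtain ⟨c, hc⟩ := hf
  exact ⟨_, ⟨fun i => (c i)ᴴ, fun z => rfl⟩, fun x => by
    simp [hc, Matrix.conjTranspose_sum, Matrix.conjTranspose_smul]⟩

theorem GeomGrowth.summable {f : ℕ → Mat N} (hf : GeomGrowth f) (a : ℝ) :
    Summable fun x : ℕ => ((a ^ x / x.factorial : ℝ) : ℂ) • f x := by
  obtain ⟨c, r, hc, hr, h⟩ := hf
  have : CompleteSpace (Mat N) := FiniteDimensional.complete ℂ _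
  refine Summable.of_norm_bounded ((Real.summable_pow_div_factorial (|a| * r)).mul_left c)
    fun x => ?_
  rw [norm_smul, Complex.norm_real, Real.norm_eq_abs, abs_div, abs_pow, Nat.abs_cast]
  calc |a| ^ x / x.factorial * ‖f x‖ ≤ |a| ^ x / x.factorial * (c * r ^ x) :=
        mul_le_mul_of_nonneg_left (h x) (by positivity)
    _ = _ := by rw [mul_pow]; ring

end Growth

section Weight

variable {N : ℕ} {a : ℝ}

theorem Tmat_conjTranspose (δ : ℕ → ℝ) : (Tmat N δ)ᴴ = Tmat N δ := by
  rw [Tmat, Matrix.diagonal_conjTranspose]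
  congr 1
  ext k
  simp

theorem isWeight_Wch (N : ℕ) (a : ℝ) (μ δ : ℕ → ℝ) (lam : ℕ) : IsWeight (Wch N a μ δ lam) where
  herm x := by
    rw [Wch, Matrix.conjTranspose_smul, Matrix.conjTranspose_mul, Matrix.conjTranspose_mul,
      Matrix.conjTranspose_pow, Matrix.conjTranspose_pow, Tmat_conjTranspose]
    simp [Matrix.mul_assoc]
  summable {m n f g} hf hg := by
    obtain ⟨h, hh, hgh⟩ := exists_conjTranspose_mem_degLT hg
    have := ((geomGrowth_of_mem_degLT hf).mul
      ((((geomGrowth_pow (1 + Amat N μ)).mul (geomGrowth_const ((1 + Amat N μ) ^ lam))).mul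
        (geomGrowth_const (Tmat N δ))).mul ((geomGrowth_pow (1 + (Amat N μ)ᴴ)).mul
        (geomGrowth_const ((1 + (Amat N μ)ᴴ) ^ lam))))).mul (geomGrowth_of_mem_degLT hh)
    refine (this.summable a).congr fun x => ?_
    simp only [hgh, Wch, pow_add, mul_smul_comm, smul_mul_assoc]

end Weight

section ExpSandwich

variable {E : Type*} [NormedRing E] [NormedAlgebra ℂ E]

theorem exp_smul_eq_sum_of_pow_eq_zero {x : E} {n m : ℕ} (hx : x ^ n = 0) (hnm : n ≤ m) (c : ℂ) :
    NormedSpace.exp (c • x) = ∑ k ∈ Finset.range m, (c ^ k / (k.factorial : ℂ)) • x ^ k := by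
  rw [NormedSpace.exp_eq_tsum ℂ]
  simp only
  rw [tsum_eq_sum (s := Finset.range m)]
  · refine Finset.sum_congr rfl fun k _ => ?_
    rw [_root_.smul_pow, smul_smul, div_eq_inv_mul]
  · intro k hk
    rw [_root_.smul_pow, pow_eq_zero_of_le (by simp at hk; omega) hx, smul_zero, smul_zero]

theorem exp_neg_mul_exp_one_add_mul_one_add [CompleteSpace E] {x y : E} (h : Commute x y) (c : ℂ) :
    NormedSpace.exp ((-c) • x) * NormedSpace.exp ((-c) • y)
        * NormedSpace.exp (c • ((1 + x) * (1 + y)))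
      = Complex.exp c • NormedSpace.exp (c • (x * y)) := by
  let _ : NormedAlgebra ℚ E := NormedAlgebra.restrictScalars ℚ ℂ E
  have hx : Commute x ((1 + x) * (1 + y)) :=
    (((Commute.one_right x).add_right (Commute.refl x)).mul_right
      ((Commute.one_right x).add_right h))
  have hy : Commute y ((1 + x) * (1 + y)) :=
    (((Commute.one_right y).add_right h.symm).mul_right
      ((Commute.one_right y).add_right (Commute.refl y)))
  rw [← NormedSpace.exp_add_of_commute ((h.smul_left _).smul_right _),
    ← NormedSpace.exp_add_of_commute
      (((hx.smul_left _).smul_right _).add_left ((hy.smul_left _).smul_right _))]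
  have : (-c) • x + (-c) • y + c • ((1 + x) * (1 + y)) = c • (1 : E) + c • (x * y) := by
    simp only [add_mul, mul_add, one_mul, mul_one]
    module
  rw [this, NormedSpace.exp_add_of_commute (((Commute.one_left _).smul_left _).smul_right _),
    ← Algebra.algebraMap_eq_smul_one, ← NormedSpace.algebraMap_exp_comm, ← Algebra.smul_def,
    Complex.exp_eq_exp_ℂ]

end ExpSandwich

section ZerothMoment

variable {E : Type*} [NormedRing E] [NormedAlgebra ℂ E]

/-- Left multiplication as a continuous linear operator. -/
def lmulCLM (A : E) : E →L[ℂ] E := ContinuousLinearMap.mul ℂ E A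

/-- Right multiplication as a continuous linear operator. -/
def rmulCLM (B : E) : E →L[ℂ] E := (ContinuousLinearMap.mul ℂ E).flip B

theorem lmulCLM_apply (A M : E) : lmulCLM A M = A * M := rfl

theorem rmulCLM_apply (B M : E) : rmulCLM B M = M * B := rfl

theorem lmulCLM_pow_apply (A M : E) (k : ℕ) : (lmulCLM A ^ k) M = A ^ k * M := by
  induction k with
  | zero => simp
  | succ k ih =>
    rw [pow_succ', pow_succ', mul_apply_eq_comp, ih, lmulCLM_apply, mul_assoc]

theorem rmulCLM_pow_apply (B M : E) (k : ℕ) : (rmulCLM B ^ k) M = M * B ^ k := by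
  induction k with
  | zero => simp
  | succ k ih =>
    rw [pow_succ', pow_succ, mul_apply_eq_comp, ih, rmulCLM_apply, mul_assoc]

theorem commute_lmulCLM_rmulCLM (A B : E) : Commute (lmulCLM A) (rmulCLM B) := by
  ext1 M
  simp [lmulCLM_apply, rmulCLM_apply, mul_assoc]

theorem one_add_lmulCLM (A : E) : 1 + lmulCLM A = lmulCLM (1 + A) := by
  ext1 M
  simp [lmulCLM_apply, add_mul]

theorem one_add_rmulCLM (A : E) : 1 + rmulCLM A = rmulCLM (1 + A) := by
  ext1 M
  simp [rmulCLM_apply, mul_add]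

theorem lmulCLM_mul_rmulCLM_pow_apply (A B M : E) (k : ℕ) :
    ((lmulCLM A * rmulCLM B) ^ k) M = A ^ k * M * B ^ k := by
  rw [(commute_lmulCLM_rmulCLM A B).mul_pow, mul_apply_eq_comp, rmulCLM_pow_apply,
    lmulCLM_pow_apply, mul_assoc]

variable [CompleteSpace E]

theorem hasSum_exp_smul (x : E) (c : ℂ) :
    HasSum (fun k : ℕ => (c ^ k / (k.factorial : ℂ)) • x ^ k) (NormedSpace.exp (c • x)) := by
  refine (NormedSpace.exp_series_hasSum_exp' (𝕂 := ℂ) (c • x)).congr_fun fun k => ?_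
  rw [_root_.smul_pow, smul_smul, div_eq_inv_mul]

theorem hasSum_sandwich (A B T : E) (c : ℂ) :
    HasSum (fun x : ℕ => (c ^ x / (x.factorial : ℂ)) • ((1 + A) ^ x * T * (1 + B) ^ x))
      (NormedSpace.exp (c • ((1 + lmulCLM A) * (1 + rmulCLM B))) T) := by
  rw [one_add_lmulCLM, one_add_rmulCLM]
  refine ((hasSum_exp_smul (lmulCLM (1 + A) * rmulCLM (1 + B)) c).mapL
    (ContinuousLinearMap.apply ℂ E T)).congr_fun fun x => ?_
  rw [ContinuousLinearMap.apply_apply, _root_.smul_apply, lmulCLM_mul_rmulCLM_pow_apply]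

theorem sum_mul_tsum_sandwich_mul_sum (A B T : E) (c : ℂ) {n m : ℕ} (hA : A ^ n = 0)
    (hB : B ^ n = 0) (hnm : n ≤ m) :
    (∑ k ∈ Finset.range m, ((-c) ^ k / (k.factorial : ℂ)) • A ^ k)
      * (∑' x : ℕ, (c ^ x / (x.factorial : ℂ)) • ((1 + A) ^ x * T * (1 + B) ^ x))
      * (∑ k ∈ Finset.range m, ((-c) ^ k / (k.factorial : ℂ)) • B ^ k)
      = Complex.exp c • ∑ k ∈ Finset.range m, (c ^ k / (k.factorial : ℂ)) • (A ^ k * T * B ^ k) := by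
  rw [(hasSum_sandwich A B T c).tsum_eq]
  have h := congrArg (fun f => f T)
    (exp_neg_mul_exp_one_add_mul_one_add (commute_lmulCLM_rmulCLM A B) c)
  have hA' : lmulCLM A ^ n = 0 := by
    ext1 M
    rw [lmulCLM_pow_apply, hA, zero_mul]
    rfl
  have hB' : rmulCLM B ^ n = 0 := by
    ext1 M
    rw [rmulCLM_pow_apply, hB, mul_zero]
    rfl
  have hAB : (lmulCLM A * rmulCLM B) ^ n = 0 := by
    rw [(commute_lmulCLM_rmulCLM A B).mul_pow, hA', zero_mul]
  simp only [exp_smul_eq_sum_of_pow_eq_zero hA' hnm, exp_smul_eq_sum_of_pow_eq_zero hB' hnm,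
    exp_smul_eq_sum_of_pow_eq_zero hAB hnm, mul_apply_eq_comp,
    _root_.smul_apply, _root_.sum_apply, lmulCLM_pow_apply,
    rmulCLM_pow_apply, lmulCLM_mul_rmulCLM_pow_apply] at h
  rw [← h, mul_assoc, Finset.sum_mul]
  simp only [Finset.mul_sum, Finset.smul_sum, smul_mul_assoc, mul_smul_comm]
  exact Finset.sum_congr rfl fun x _ => Finset.sum_congr rfl fun y _ => smul_comm _ _ _

end ZerothMoment

section Diagonal

variable {N : ℕ} {a : ℝ}

theorem sum_antidiagonal_choose_mul_choose (m l i : ℕ) :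
    ∑ p ∈ Finset.HasAntidiagonal.antidiagonal i, (m + p.1).choose m * (l + p.2).choose l
      = (m + l + 1 + i).choose (m + l + 1) := by
  have h := congrArg (fun u => PowerSeries.coeff i (Units.val u))
    (PowerSeries.invOneSubPow_add ℤ (m + 1) (l + 1))
  simp only [Units.val_mul, PowerSeries.invOneSubPow_val_succ_eq_mk_add_choose,
    PowerSeries.coeff_mul, PowerSeries.coeff_mk, ← add_assoc, add_right_comm m 1 l] at h
  exact_mod_cast h.symm

theorem Dch_eq (n lam : ℕ) : Dch N a n lam = Matrix.diagonal fun j : Fin N =>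
    Complex.exp (a : ℂ) * (n.factorial : ℂ) * (a : ℂ) ^ n * ((a : ℂ) / 2) ^ lam
      * ((lam + (N - (j + 1))).factorial : ℂ) * ((N + lam + n).factorial : ℂ)
      * ((lam + n).factorial : ℂ) / ((j : ℕ).factorial * ((N + lam + n - (j + 1)).factorial : ℂ)
        * ((lam + n + (N - j)).factorial : ℂ)) := by
  rw [Dch]
  congr 1
  ext j
  have h1 : (ascPochhammer ℂ ((j : ℕ) + 1)).eval (-((N : ℂ) + (lam : ℂ) + (n : ℂ)))
      = (-1) ^ ((j : ℕ) + 1) * (((N + lam + n).factorial : ℂ)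
        / ((N + lam + n - (j + 1)).factorial : ℂ)) := by
    have h := Nat.factorial_mul_descFactorial (show (j : ℕ) + 1 ≤ N + lam + n by omega)
    rw [ascPochhammer_eval_neg_eq_descPochhammer, ← h]
    have : ((N + lam + n - (j + 1)).factorial : ℂ) ≠ 0 := by
      exact_mod_cast Nat.factorial_ne_zero _
    have h' := descPochhammer_eval_eq_descFactorial ℂ (N + lam + n) (j + 1)
    push_cast at h' ⊢
    rw [h', mul_div_cancel_left₀ _ this]
  have h2 : (ascPochhammer ℂ (N - (j : ℕ))).eval ((lam : ℂ) + (n : ℂ) + 1)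
      = ((lam + n + (N - j)).factorial : ℂ) / ((lam + n).factorial : ℂ) := by
    have : ((lam + n).factorial : ℂ) ≠ 0 := by exact_mod_cast Nat.factorial_ne_zero _
    rw [← Nat.factorial_mul_ascFactorial]
    have h' := ascPochhammer_eval_cast (S := ℂ) (N - j) (lam + n + 1)
    rw [ascPochhammer_nat_eq_ascFactorial] at h'
    push_cast at h' ⊢
    rw [← h', mul_div_cancel_left₀ _ this]
  rw [h1, h2]
  have hs : ((-1 : ℂ) ^ ((j : ℕ) + 1)) * (-1) ^ ((j : ℕ) + 1) = 1 := by
    rw [← mul_pow]; simp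
  rw [div_div_eq_mul_div, show ∀ s e1 e2 e3 e4 e5 f g h i : ℂ,
    s * e1 * e2 * e3 * e4 * e5 / f * (s * g) * h / i = s * s * (e1 * e2 * e3 * e4 * e5 / f * g * h / i)
    by intros; ring, hs]
  ring

theorem sum_pow_mul_Tmat_mul_pow (ha : 0 < a) (lam : ℕ) :
    Complex.exp a • ∑ k ∈ Finset.range (N + 2), ((a : ℂ) ^ k / (k.factorial : ℂ)) •
      (Amat N (μch N a) ^ k * Tmat N (δch a lam) * (Amat N (μch N a))ᴴ ^ k)
      = Dch N a 0 lam := by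
  rw [Dch_eq]
  ext i j
  simp only [Matrix.smul_apply, Matrix.sum_apply, ← Matrix.conjTranspose_pow, Tmat]
  have key : ∀ k : ℕ, (Amat N (μch N a) ^ k * Matrix.diagonal (fun k : Fin N =>
      ((δch a lam ((k : ℕ) + 1) : ℝ) : ℂ)) * (Amat N (μch N a) ^ k)ᴴ) i j
      = if i = j ∧ k ≤ i then (((μch N a (i + 1) / μch N a (i - k + 1)) ^ 2
        * δch a lam (i - k + 1) : ℝ) : ℂ) else 0 := by
    intro k
    rw [Matrix.mul_apply]
    simp only [Matrix.mul_diagonal, Matrix.conjTranspose_apply, Amat_pow_apply ha]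
    split_ifs with h
    · obtain ⟨rfl, hk⟩ := h
      rw [Finset.sum_eq_single ⟨(i : ℕ) - k, by omega⟩]
      · simp only [Nat.sub_add_cancel hk, if_true, Complex.star_def, Complex.conj_ofReal]
        push_cast
        ring
      · intro l _ hl
        rw [if_neg, zero_mul, zero_mul]
        exact fun h => hl (Fin.ext (by simp; omega))
      · simp
    · refine Finset.sum_eq_zero fun l _ => ?_
      by_cases h1 : (i : ℕ) = l + k
      · rw [if_neg (c := (j : ℕ) = l + k), star_zero, mul_zero]
        exact fun h2 => h ⟨Fin.ext (by omega), by omega⟩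
      · rw [if_neg h1, zero_mul, zero_mul]
  simp only [key]
  by_cases hij : i = j
  · subst hij
    rw [Matrix.diagonal_apply_eq]
    simp only [true_and, smul_eq_mul]
    obtain ⟨m, hm⟩ := Nat.exists_eq_add_of_lt i.isLt
    have hsub : Finset.range ((i : ℕ) + 1) ⊆ Finset.range (N + 2) :=
      Finset.range_mono (by omega)
    rw [← Finset.sum_subset hsub fun k _ hk => by
      rw [if_neg (by simpa [Nat.lt_succ_iff] using hk), mul_zero]]
    have hterm : ∀ k ∈ Finset.range ((i : ℕ) + 1), (a : ℂ) ^ k / (k.factorial : ℂ) *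
        (if k ≤ (i : ℕ) then (((μch N a (i + 1) / μch N a (i - k + 1)) ^ 2
        * δch a lam (i - k + 1) : ℝ) : ℂ) else 0) = (a / 2 : ℂ) ^ lam * (lam.factorial : ℂ) *
          (((m + k).choose m * (lam + (i - k)).choose lam : ℕ) : ℂ) := by
      intro k hk
      have hk' : k ≤ i := Nat.lt_succ_iff.1 (Finset.mem_range.1 hk)
      rw [if_pos hk', div_pow, μch_sq ha, μch_sq ha, δch]
      obtain ⟨d, hd⟩ := Nat.exists_eq_add_of_le hk'
      rw [hd, show k + d - k = d by omega, show N - (k + d + 1) = m by omega,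
        show N - (d + 1) = m + k by omega, show lam + (d + 1) - 1 = lam + d by omega,
        Nat.add_sub_cancel, Nat.cast_mul, Nat.cast_add_choose, Nat.cast_add_choose]
      have h1 : (k.factorial : ℂ) ≠ 0 := by exact_mod_cast Nat.factorial_ne_zero _
      have h2 : (d.factorial : ℂ) ≠ 0 := by exact_mod_cast Nat.factorial_ne_zero _
      have h3 : (m.factorial : ℂ) ≠ 0 := by exact_mod_cast Nat.factorial_ne_zero _
      have h4 : (lam.factorial : ℂ) ≠ 0 := by exact_mod_cast Nat.factorial_ne_zero _
      have h5 : (a : ℂ) ≠ 0 := by exact_mod_cast ha.ne'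
      push_cast
      field_simp
      ring
    rw [Finset.sum_congr rfl hterm, ← Finset.mul_sum, ← Nat.cast_sum,
      ← Finset.Nat.sum_antidiagonal_eq_sum_range_succ
        (fun p q => (m + p).choose m * (lam + q).choose lam),
      sum_antidiagonal_choose_mul_choose, Nat.cast_add_choose]
    rw [show m + lam + 1 + (i : ℕ) = N + lam by omega, add_zero, add_zero,
      show N + lam - ((i : ℕ) + 1) = lam + (N - (i + 1)) by omega,
      show m + lam + 1 = lam + (N - (i : ℕ)) by omega]
    have h1 : ((lam + (N - ((i : ℕ) + 1))).factorial : ℂ) ≠ 0 := by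
      exact_mod_cast Nat.factorial_ne_zero _
    simp only [Nat.factorial_zero, Nat.cast_one, pow_zero]
    field_simp
  · rw [Matrix.diagonal_apply_ne _ hij]
    simp [hij]

theorem Lmat_zero_eq_sum (ha : 0 < a) : Lmat N a (μch N a) 0 = ∑ k ∈ Finset.range (N + 2),
    ((-(a : ℂ)) ^ k / (k.factorial : ℂ)) • Amat N (μch N a) ^ k := by
  rw [Lmat_zero_eq_aeval ha, expTrunc, map_sum]
  simp only [map_mul, aeval_C, map_pow, aeval_X, Algebra.smul_def]

theorem Wch_eq (a : ℝ) (μ δ : ℕ → ℝ) (lam x : ℕ) :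
    Wch N a μ δ lam x = ((a : ℂ) ^ x / (x.factorial : ℂ)) • ((1 + Amat N μ) ^ x
      * ((1 + Amat N μ) ^ lam * Tmat N δ * ((1 + Amat N μ) ^ lam)ᴴ) * (1 + (Amat N μ)ᴴ) ^ x) := by
  rw [Wch, pow_add, add_comm x, pow_add]
  simp [Matrix.mul_assoc]

theorem sum_pow_mul_conj_mul_pow (ha : 0 < a) (lam : ℕ) :
    Complex.exp a • ∑ k ∈ Finset.range (N + 2), ((a : ℂ) ^ k / (k.factorial : ℂ)) •
      (Amat N (μch N a) ^ k * ((1 + Amat N (μch N a)) ^ lam * Tmat N (δch a lam)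
        * ((1 + Amat N (μch N a)) ^ lam)ᴴ) * (Amat N (μch N a))ᴴ ^ k)
      = (1 + Amat N (μch N a)) ^ lam * Dch N a 0 lam * ((1 + Amat N (μch N a)) ^ lam)ᴴ := by
  rw [← sum_pow_mul_Tmat_mul_pow ha]
  simp only [Finset.mul_sum, Finset.sum_mul, smul_mul_assoc, mul_smul_comm]
  congr 1
  refine Finset.sum_congr rfl fun k _ => congrArg _ ?_
  have h1 : Commute (Amat N (μch N a) ^ k) ((1 + Amat N (μch N a)) ^ lam) :=
    (((Commute.one_right _).add_right (Commute.refl _)).pow_right _).pow_left _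
  have h2 := congrArg Matrix.conjTranspose h1.eq
  rw [Matrix.conjTranspose_mul, Matrix.conjTranspose_mul,
    Matrix.conjTranspose_pow (Amat N (μch N a))] at h2
  simp only [← Matrix.mul_assoc]
  rw [h1.eq, Matrix.mul_assoc _ _ ((Amat N (μch N a))ᴴ ^ k), h2]
  simp only [← Matrix.mul_assoc]

attribute [local instance] Matrix.linftyOpNormedRing Matrix.linftyOpNormedAlgebra in
theorem Lmat_mul_tsum_Wch_mul (ha : 0 < a) (lam : ℕ) :
    Lmat N a (μch N a) 0 * (∑' x, Wch N a (μch N a) (δch a lam) lam x) * (Lmat N a (μch N a) 0)ᴴ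
      = (1 + Amat N (μch N a)) ^ lam * Dch N a 0 lam * ((1 + Amat N (μch N a)) ^ lam)ᴴ := by
  have : CompleteSpace (Mat N) := FiniteDimensional.complete ℂ _
  have hA : Amat N (μch N a) ^ N = 0 := Amat_pow_card ha
  have hA' : (Amat N (μch N a))ᴴ ^ N = 0 := by
    rw [← Matrix.conjTranspose_pow, hA, Matrix.conjTranspose_zero]
  have hL : (Lmat N a (μch N a) 0)ᴴ = ∑ k ∈ Finset.range (N + 2),
      ((-(a : ℂ)) ^ k / (k.factorial : ℂ)) • (Amat N (μch N a))ᴴ ^ k := by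
    rw [Lmat_zero_eq_sum ha, Matrix.conjTranspose_sum]
    simp
  rw [hL, Lmat_zero_eq_sum ha]
  simp only [Wch_eq]
  exact (sum_mul_tsum_sandwich_mul_sum _ _ _ (a : ℂ) hA hA' (Nat.le_add_right N 2)).trans
    (sum_pow_mul_conj_mul_pow ha lam)

end Diagonal

section WeightShift

variable {N : ℕ} {a : ℝ}

theorem one_add_Amat_mul_inv (μ : ℕ → ℝ) : (1 + Amat N μ) * (1 + Amat N μ)⁻¹ = 1 :=
  Matrix.mul_nonsing_inv _ (isUnit_det_one_add_Amat μ)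

theorem one_add_Amat_mul_Umat : (1 + Amat N (μch N a)) * Umat N a = Amat N (μch N a) := by
  rw [Umat, (commute_Amat_inv _).eq, ← Matrix.mul_assoc, one_add_Amat_mul_inv, Matrix.one_mul]

theorem one_add_Amat_mul_Smat_mul_inv :
    (1 + Amat N (μch N a)) * (Smat N a * (1 + Amat N (μch N a))⁻¹)
      = Smat N a - (2 * (1 / (a : ℂ))) • Umat N a := by
  have h : (1 + Amat N (μch N a)) * Smat N a
      = Smat N a * (1 + Amat N (μch N a)) - (2 * (1 / (a : ℂ))) • Amat N (μch N a) := by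
    rw [add_mul, Amat_mul_Smat, one_mul, mul_add, mul_one, add_sub_assoc]
  rw [← Matrix.mul_assoc, h, sub_mul, Matrix.mul_assoc, one_add_Amat_mul_inv, Matrix.mul_one,
    Matrix.smul_mul, Umat]

theorem one_add_Amat_mul_Umat_mul_inv :
    (1 + Amat N (μch N a)) * (Umat N a * (1 + Amat N (μch N a))⁻¹) = Umat N a := by
  rw [← Matrix.mul_assoc, one_add_Amat_mul_Umat, Umat]

/-- The matrix polynomial `Ψ` with `W^{(λ+1)}(x) = Ψ(x) W^{(λ)}(x)`. -/
def Psi (N : ℕ) (a : ℝ) (lam : ℕ) (z : ℂ) : Mat N :=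
  ((a : ℂ) / 2) • ((1 + Amat N (μch N a)) * ((lam : ℂ) • (1 : Mat N) + Jdiag N + Fmat N a))
    + ((z + lam) * a / 2) • (Smat N a - Amat N (μch N a))
    - ((z + lam) * (z + lam + 1) / 2) • Umat N a

/-- The matrix polynomial `Ω` with `W^{(λ+1)}(x-1) = Ω(x) W^{(λ)}(x)`. -/
def Omega (N : ℕ) (a : ℝ) (lam : ℕ) (z : ℂ) : Mat N :=
  (z / 2) • ((lam : ℂ) • (1 : Mat N) + Jdiag N - (z + lam) • Umat N a)

theorem one_add_pow_mul_Psi (ha : 0 < a) (lam x : ℕ) :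
    Psi N a lam x * (1 + Amat N (μch N a)) ^ (x + lam)
      = (1 + Amat N (μch N a)) ^ (x + lam) * (((a : ℂ) / 2) • ((1 + Amat N (μch N a))
        * ((lam : ℂ) • (1 : Mat N) + Jdiag N + Fmat N a))) := by
  have ha' : (a : ℂ) ≠ 0 := by exact_mod_cast ha.ne'
  have hV : (1 + Amat N (μch N a)) ^ (x + lam) * ((lam : ℂ) • (1 : Mat N) + Jdiag N + Fmat N a)
      = ((lam : ℂ) • (1 : Mat N) + (Jdiag N - ((x + lam : ℕ) : ℂ) • Umat N a)
        + (Fmat N a + ((x + lam : ℕ) : ℂ) • (Smat N a * (1 + Amat N (μch N a))⁻¹)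
          - ((1 / (a : ℂ)) * ((x + lam : ℕ) * ((x + lam : ℕ) - 1)))
            • (Umat N a * (1 + Amat N (μch N a))⁻¹))) * (1 + Amat N (μch N a)) ^ (x + lam) := by
    rw [mul_add, mul_add, one_add_pow_mul_Jdiag, one_add_pow_mul_Fmat ha, add_mul _ _
      ((1 + Amat N (μch N a)) ^ (x + lam)), add_mul _ _ ((1 + Amat N (μch N a)) ^ (x + lam))]
    simp
  rw [Matrix.mul_smul, ← Matrix.mul_assoc, ← pow_succ, pow_succ', Matrix.mul_assoc, hV,
    ← Matrix.mul_assoc, ← Matrix.smul_mul]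
  congr 1
  have h (c d : ℂ) : (1 + Amat N (μch N a)) * ((lam : ℂ) • (1 : Mat N)
      + (Jdiag N - c • Umat N a) + (Fmat N a + c • (Smat N a * (1 + Amat N (μch N a))⁻¹)
        - d • (Umat N a * (1 + Amat N (μch N a))⁻¹)))
      = (1 + Amat N (μch N a)) * ((lam : ℂ) • (1 : Mat N) + Jdiag N + Fmat N a)
        - c • ((1 + Amat N (μch N a)) * Umat N a)
        + c • ((1 + Amat N (μch N a)) * (Smat N a * (1 + Amat N (μch N a))⁻¹))
        - d • ((1 + Amat N (μch N a)) * (Umat N a * (1 + Amat N (μch N a))⁻¹)) := by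
    simp only [mul_add (1 + Amat N (μch N a)), mul_sub (1 + Amat N (μch N a)),
      mul_smul_comm _ (1 + Amat N (μch N a))]
    abel
  rw [h, one_add_Amat_mul_Umat, one_add_Amat_mul_Smat_mul_inv, one_add_Amat_mul_Umat_mul_inv, Psi]
  push_cast
  match_scalars <;> field_simp
  ring

theorem Tmat_succ (a : ℝ) (lam : ℕ) : Tmat N (δch a (lam + 1))
    = ((a : ℂ) / 2) • (((lam : ℂ) • (1 : Mat N) + Jdiag N) * Tmat N (δch a lam)) := by
  ext i j
  rw [Matrix.smul_apply, Tmat, Tmat, Matrix.mul_diagonal, Matrix.add_apply, Matrix.smul_apply,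
    Jdiag_apply, Matrix.diagonal_apply, Matrix.one_apply]
  by_cases h : i = j
  · subst h
    have h1 : (lam + i + 1).factorial = (lam + i + 1) * (lam + i).factorial := Nat.factorial_succ _
    simp only [if_true, δch, smul_eq_mul, show lam + 1 + ((i : ℕ) + 1) - 1 = lam + i + 1 by omega,
      show lam + ((i : ℕ) + 1) - 1 = lam + i by omega, h1]
    push_cast
    ring
  · simp [h]

theorem Tmat_succ_mul_conjTranspose (a : ℝ) (lam : ℕ) :
    Tmat N (δch a (lam + 1)) * (Amat N (μch N a))ᴴ
      = ((a : ℂ) / 2) • (Fmat N a * Tmat N (δch a lam)) := by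
  ext i j
  rw [Matrix.smul_apply, Tmat, Tmat, Matrix.mul_diagonal, Matrix.diagonal_mul, Fmat, Jdiag,
    Matrix.diagonal_mul, Amat_conjTranspose_apply]
  split_ifs with h
  · have h1 : ((i : ℕ) + 1).factorial = (i + 1) * (i : ℕ).factorial := Nat.factorial_succ _
    have h2 : ((i : ℕ).factorial : ℂ) ≠ 0 := by exact_mod_cast Nat.factorial_ne_zero _
    have h3 : ((i : ℕ) : ℂ) + 1 ≠ 0 := Nat.cast_add_one_ne_zero _
    simp only [h, δch, show lam + 1 + ((i : ℕ) + 1) - 1 = lam + i + 1 by omega,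
      show lam + ((i : ℕ) + 1 + 1) - 1 = lam + i + 1 by omega, Nat.add_sub_cancel, h1, smul_eq_mul]
    push_cast
    field_simp
    ring
  · simp

theorem Wch_succ (ha : 0 < a) (lam x : ℕ) :
    Wch N a (μch N a) (δch a (lam + 1)) (lam + 1) x
      = Psi N a lam x * Wch N a (μch N a) (δch a lam) lam x := by
  have h : Tmat N (δch a (lam + 1)) * (1 + (Amat N (μch N a))ᴴ)
      = (((a : ℂ) / 2) • ((lam : ℂ) • (1 : Mat N) + Jdiag N + Fmat N a)) * Tmat N (δch a lam) := by
    rw [mul_add, Tmat_succ_mul_conjTranspose, mul_one, Tmat_succ, ← smul_add, ← add_mul,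
      smul_mul_assoc]
  rw [Wch, Wch, Matrix.mul_smul, ← add_assoc, pow_succ, pow_succ', ← Matrix.mul_assoc,
    Matrix.mul_assoc _ (Tmat N (δch a (lam + 1))), h, ← Matrix.mul_assoc, ← Matrix.mul_assoc,
    ← Matrix.mul_assoc, one_add_pow_mul_Psi ha]
  simp only [mul_smul_comm, Matrix.mul_assoc]

theorem Wch_succ_eq_Omega_mul (a : ℝ) (lam x : ℕ) :
    Wch N a (μch N a) (δch a (lam + 1)) (lam + 1) x
      = Omega N a lam ((x + 1 : ℕ) : ℂ) * Wch N a (μch N a) (δch a lam) lam (x + 1) := by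
  have h : (1 + Amat N (μch N a)) ^ (x + 1 + lam) * ((lam : ℂ) • (1 : Mat N) + Jdiag N)
      = ((lam : ℂ) • (1 : Mat N) + Jdiag N - (((x + 1 : ℕ) : ℂ) + lam) • Umat N a)
        * (1 + Amat N (μch N a)) ^ (x + 1 + lam) := by
    rw [mul_add, one_add_pow_mul_Jdiag, add_sub_assoc, add_mul]
    simp
  rw [Wch, Wch, Tmat_succ, Omega, show x + (lam + 1) = x + 1 + lam by omega, Matrix.mul_smul,
    Matrix.smul_mul, Matrix.mul_smul, smul_smul, Matrix.smul_mul, smul_smul, ← Matrix.mul_assoc, h]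
  simp only [Matrix.mul_assoc]
  congr 1
  have h1 : ((x : ℕ).factorial : ℂ) ≠ 0 := by exact_mod_cast Nat.factorial_ne_zero _
  have h3 : (x : ℂ) + 1 ≠ 0 := Nat.cast_add_one_ne_zero _
  rw [Nat.factorial_succ]
  push_cast
  field_simp
  ring

end WeightShift

theorem ip_sub_shift {N : ℕ} {W W' : ℕ → Mat N} {Ψ Ω : ℂ → Mat N} (hW' : IsWeight W')
    (hΨ : ∀ x : ℕ, W' x = Ψ x * W x) (hΩ : ∀ x : ℕ, W' x = Ω (x + 1 : ℕ) * W (x + 1))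
    (hΩ0 : Ω 0 = 0) {m n : ℕ} {f g : ℂ → Mat N} (hg : g ∈ degLT N m) (hf : f ∈ degLT N n) :
    ip W (fun z => g z * Ψ z - g (z - 1) * Ω z) f = -ip W' g (fun z => f (z + 1) - f z) := by
  have h0 (x : ℕ) : g x * W' x * (f x)ᴴ = g x * Ψ x * W x * (f x)ᴴ := by
    simp only [hΨ, Matrix.mul_assoc]
  have h1 : Summable fun x : ℕ => g x * W' x * (f x)ᴴ := hW'.summable hg hf
  have h2 : Summable fun x : ℕ => g x * W' x * (f (x + 1))ᴴ :=
    hW'.summable (g := fun z => f (z + 1)) hg (shift_mem_degLT hf 1)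
  have h3 (x : ℕ) : g ((x + 1 : ℕ) - 1) * Ω (x + 1 : ℕ) * W (x + 1) * (f (x + 1 : ℕ))ᴴ
      = g x * W' x * (f (x + 1))ᴴ := by
    simp only [hΩ, Nat.cast_succ, add_sub_cancel_right, Matrix.mul_assoc]
  have h4 : Summable fun x : ℕ => g (x - 1) * Ω x * W x * (f x)ᴴ := by
    rw [← summable_nat_add_iff 1]
    exact h2.congr fun x => (h3 x).symm
  have h5 : ∑' x : ℕ, g (x - 1) * Ω x * W x * (f x)ᴴ = ∑' x : ℕ, g x * W' x * (f (x + 1))ᴴ := by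
    rw [h4.tsum_eq_zero_add]
    simp only [h3]
    simp [hΩ0]
  simp only [ip, sub_mul, Matrix.conjTranspose_sub, mul_sub, ← h0]
  rw [h1.tsum_sub h4, h5, h2.tsum_sub h1, neg_sub]

section ShiftOperator

variable {N : ℕ} {a : ℝ}

/-- The backward shift operator attached to the factors `Ψ` and `Ω`. -/
def shiftOp (N : ℕ) (a : ℝ) (lam : ℕ) (g : ℂ → Mat N) : ℂ → Mat N :=
  fun z => g z * Psi N a lam z - g (z - 1) * Omega N a lam z

/-- The matrix by which the backward shift operator multiplies leading coefficients. -/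
def shiftCoeff (N : ℕ) (a : ℝ) (lam n : ℕ) : Mat N :=
  (-(1 / 2 : ℂ)) • (((N : ℂ) + lam + 1) • (1 : Mat N) - Jdiag N
    + (a : ℂ) • Amat N (μch N a) + ((lam : ℂ) + n) • Umat N a)

theorem ip_shiftOp_left (ha : 0 < a) (lam : ℕ) {m n : ℕ} {f g : ℂ → Mat N} (hg : g ∈ degLT N m)
    (hf : f ∈ degLT N n) :
    ip (Wch N a (μch N a) (δch a lam) lam) (shiftOp N a lam g) f
      = -ip (Wch N a (μch N a) (δch a (lam + 1)) (lam + 1)) g (fun z => f (z + 1) - f z) :=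
  ip_sub_shift (isWeight_Wch ..) (Wch_succ ha lam) (Wch_succ_eq_Omega_mul a lam)
    (by simp [Omega]) hg hf

theorem ip_shiftOp_right (ha : 0 < a) (lam : ℕ) {m n : ℕ} {f g : ℂ → Mat N} (hg : g ∈ degLT N m)
    (hf : f ∈ degLT N n) :
    ip (Wch N a (μch N a) (δch a lam) lam) f (shiftOp N a lam g)
      = -ip (Wch N a (μch N a) (δch a (lam + 1)) (lam + 1)) (fun z => f (z + 1) - f z) g := by
  rw [← (isWeight_Wch ..).ip_conjTranspose, ip_shiftOp_left ha lam hg hf,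
    Matrix.conjTranspose_neg, (isWeight_Wch ..).ip_conjTranspose]

theorem shiftOp_apply (lam : ℕ) (g : ℂ → Mat N) (z : ℂ) : shiftOp N a lam g z
    = g z * Psi N a lam 0
      + z • (g z * (((a : ℂ) / 2) • (Smat N a - Amat N (μch N a))
          - ((2 * (lam : ℂ) + 1) / 2) • Umat N a)
        - g (z - 1) * ((1 / 2 : ℂ) • ((lam : ℂ) • (1 : Mat N) + Jdiag N - (lam : ℂ) • Umat N a)))
      + z • z • ((g (z + -1) - g z) * ((1 / 2 : ℂ) • Umat N a)) := by
  simp only [shiftOp, Psi, Omega, mul_add, mul_sub, mul_smul_comm, sub_mul, ← sub_eq_add_neg]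
  module

theorem shiftOp_mem_degLT (lam : ℕ) {m : ℕ} {g : ℂ → Mat N} (hg : g ∈ degLT N m) :
    shiftOp N a lam g ∈ degLT N (m + 1) := by
  rw [funext (shiftOp_apply lam g)]
  refine add_mem (add_mem (degLT_mono m.le_succ (mul_const_mem_degLT hg _))
    (smul_mem_degLT (sub_mem (mul_const_mem_degLT hg _)
      (mul_const_mem_degLT (shift_mem_degLT hg (-1)) _)))) ?_
  cases m with
  | zero =>
    obtain ⟨c, hc⟩ := hg
    simp only [hc, Finset.range_zero, Finset.sum_empty, sub_zero, zero_mul, smul_zero]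
    exact zero_mem (degLT N 1)
  | succ m => exact smul_mem_degLT (smul_mem_degLT (mul_const_mem_degLT (difference_mem_degLT hg _) _))

theorem shiftOp_monomial_sub_mem (ha : 0 < a) (lam m : ℕ) (c : Mat N) :
    (shiftOp N a lam (fun z => z ^ m • c) - fun z => z ^ (m + 1) • (c * shiftCoeff N a lam (m + 1)))
      ∈ degLT N (m + 1) := by
  set ω := (1 / 2 : ℂ) • ((lam : ℂ) • (1 : Mat N) + Jdiag N - (lam : ℂ) • Umat N a) with hω
  set u := c * ((1 / 2 : ℂ) • Umat N a) with hu
  have h3 : (fun z => z • ((z + -1) ^ m • u - z ^ m • u) + z ^ m • (m : ℂ) • u) ∈ degLT N m := by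
    cases m with
    | zero =>
      simp only [pow_zero, sub_self, smul_zero, Nat.cast_zero, zero_smul, add_zero]
      exact zero_mem (degLT N 0)
    | succ m =>
      have := smul_mem_degLT (monomial_difference_sub_mem_degLT m (-1) u)
      convert this using 2 with z
      push_cast
      module
  have h2 := smul_mem_degLT (monomial_difference_mem_degLT m (-1) (c * ω))
  have h1 := monomial_mem_degLT m (c * Psi N a lam 0)
  convert add_mem (sub_mem h1 h2) (smul_mem_degLT h3) using 1
  ext1 z
  have hK : c * shiftCoeff N a lam (m + 1) = c * (((a : ℂ) / 2) • (Smat N a - Amat N (μch N a))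
      - ((2 * (lam : ℂ) + 1) / 2) • Umat N a) - c * ω - (m : ℂ) • u := by
    have ha' : (a : ℂ) ≠ 0 := by exact_mod_cast ha.ne'
    rw [hu, ← mul_smul_comm, ← mul_sub, ← mul_sub, hω, shiftCoeff, Smat]
    congr 1
    push_cast
    match_scalars <;> field_simp <;> ring
  simp only [Pi.sub_apply, Pi.add_apply, shiftOp_apply, hK, smul_mul_assoc, sub_mul, ← hω, ← hu,
    ← sub_eq_add_neg]
  module

theorem shiftOp_sub_mem (ha : 0 < a) (lam : ℕ) {m : ℕ} {g : ℂ → Mat N} {c : Mat N}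
    (hg : (g - fun z => z ^ m • c) ∈ degLT N m) :
    (shiftOp N a lam g - fun z => z ^ (m + 1) • (c * shiftCoeff N a lam (m + 1)))
      ∈ degLT N (m + 1) := by
  convert add_mem (shiftOp_mem_degLT (a := a) lam hg) (shiftOp_monomial_sub_mem ha lam m c) using 1
  ext1 z
  simp only [shiftOp, Pi.sub_apply, Pi.add_apply, sub_mul]
  abel

end ShiftOperator

section SquaredNorm

variable {N : ℕ} {a : ℝ}

theorem difference_sub_mem_degLT {n : ℕ} {f : ℂ → Mat N} {c : Mat N}
    (hf : (f - fun z => z ^ (n + 1) • c) ∈ degLT N (n + 1)) :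
    ((fun z => f (z + 1) - f z) - fun z => z ^ n • ((n : ℂ) + 1) • c) ∈ degLT N n := by
  convert add_mem (difference_mem_degLT hf 1) (monomial_difference_sub_mem_degLT n 1 c) using 1
  ext1 z
  simp only [Pi.sub_apply, Pi.add_apply, mul_one]
  abel

/-- The matrix `L₀⁻¹ (I + A)^ν` diagonalizing the squared norms. -/
def baseChange (N : ℕ) (a : ℝ) (ν : ℕ) : Mat N :=
  (Lmat N a (μch N a) 0)⁻¹ * (1 + Amat N (μch N a)) ^ ν

theorem isUnit_det_baseChange (ha : 0 < a) (ν : ℕ) : IsUnit (baseChange N a ν).det := by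
  rw [baseChange, Matrix.det_mul, Matrix.det_pow]
  exact (Matrix.isUnit_nonsing_inv_det _ (isUnit_det_Lmat_zero ha)).mul
    ((isUnit_det_one_add_Amat _).pow _)

theorem baseChange_succ (ν : ℕ) :
    baseChange N a (ν + 1) = baseChange N a ν * (1 + Amat N (μch N a)) := by
  rw [baseChange, baseChange, pow_succ, Matrix.mul_assoc]

theorem nonsing_inv_mul_of_mul_eq {M M' L : Mat N} (hL : IsUnit L.det) (h : L * M = M' * L) :
    L⁻¹ * M' = M * L⁻¹ := by
  calc L⁻¹ * M' = L⁻¹ * (M' * L) * L⁻¹ := by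
        rw [Matrix.mul_assoc, Matrix.mul_assoc, Matrix.mul_nonsing_inv _ hL, Matrix.mul_one]
    _ = M * L⁻¹ := by
        rw [← h, ← Matrix.mul_assoc, Matrix.nonsing_inv_mul _ hL, Matrix.one_mul]

theorem Lmat_inv_mul_Amat (ha : 0 < a) : (Lmat N a (μch N a) 0)⁻¹ * Amat N (μch N a)
    = Amat N (μch N a) * (Lmat N a (μch N a) 0)⁻¹ :=
  nonsing_inv_mul_of_mul_eq (isUnit_det_Lmat_zero ha) (commute_Lmat_Amat ha).eq

theorem commute_Lmat_inv_Umat (ha : 0 < a) :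
    (Lmat N a (μch N a) 0)⁻¹ * Umat N a = Umat N a * (Lmat N a (μch N a) 0)⁻¹ := by
  have h : (Lmat N a (μch N a) 0)⁻¹ * (1 + Amat N (μch N a))⁻¹
      = (1 + Amat N (μch N a))⁻¹ * (Lmat N a (μch N a) 0)⁻¹ := by
    rw [← Matrix.mul_inv_rev, ← Matrix.mul_inv_rev]
    congr 1
    exact ((Commute.one_left _).add_left (commute_Lmat_Amat ha).symm).eq
  rw [Umat, ← Matrix.mul_assoc, Lmat_inv_mul_Amat ha, Matrix.mul_assoc, h, Matrix.mul_assoc]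

theorem baseChange_mul_Jdiag (ha : 0 < a) (ν : ℕ) : baseChange N a ν * Jdiag N
    = (Jdiag N - (a : ℂ) • Amat N (μch N a) - (ν : ℂ) • Umat N a) * baseChange N a ν := by
  have h : (Lmat N a (μch N a) 0)⁻¹ * Jdiag N
      = (Jdiag N - (a : ℂ) • Amat N (μch N a)) * (Lmat N a (μch N a) 0)⁻¹ := by
    have := nonsing_inv_mul_of_mul_eq (isUnit_det_Lmat_zero ha) (Lmat_mul_Jdiag (N := N) ha)
    rw [mul_add, mul_smul_comm, Lmat_inv_mul_Amat ha] at this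
    rw [sub_mul, ← this, smul_mul_assoc, add_sub_cancel_right]
  rw [baseChange, Matrix.mul_assoc, one_add_pow_mul_Jdiag, ← Matrix.mul_assoc, mul_sub, h,
    mul_smul_comm, commute_Lmat_inv_Umat ha, ← Matrix.mul_assoc, sub_mul _ ((ν : ℂ) • Umat N a),
    smul_mul_assoc]

theorem shiftCoeff_mul_baseChange (ha : 0 < a) (lam n : ℕ) :
    shiftCoeff N a lam n * baseChange N a (n + lam)
      = baseChange N a (n + lam)
        * ((-(1 / 2 : ℂ)) • (((N : ℂ) + lam + 1) • (1 : Mat N) - Jdiag N)) := by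
  rw [mul_smul_comm, mul_sub, baseChange_mul_Jdiag ha, shiftCoeff, smul_mul_assoc, mul_smul_comm,
    mul_one]
  congr 1
  rw [show ((N : ℂ) + lam + 1) • baseChange N a (n + lam)
    = (((N : ℂ) + lam + 1) • (1 : Mat N)) * baseChange N a (n + lam) by
      rw [smul_mul_assoc, one_mul], ← sub_mul]
  congr 1
  push_cast
  module

theorem sub_Jdiag_eq_diagonal (c : ℂ) : c • (1 : Mat N) - Jdiag N
    = Matrix.diagonal fun j : Fin N => c - ((j : ℂ) + 1) := by
  ext i j
  rw [Jdiag, Matrix.sub_apply, Matrix.smul_apply, Matrix.one_apply, Matrix.diagonal_apply,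
    Matrix.diagonal_apply]
  split_ifs <;> simp

theorem isUnit_det_sub_Jdiag (lam : ℕ) :
    IsUnit (((N : ℂ) + lam + 1) • (1 : Mat N) - Jdiag N).det := by
  rw [sub_Jdiag_eq_diagonal, Matrix.det_diagonal, isUnit_iff_ne_zero, Finset.prod_ne_zero_iff]
  intro j _
  obtain ⟨m, hm⟩ := Nat.exists_eq_add_of_lt j.isLt
  have : (N : ℂ) + lam + 1 - ((j : ℂ) + 1) = ((lam + m + 1 : ℕ) : ℂ) := by
    have hm' : (N : ℂ) = (j : ℕ) + m + 1 := by exact_mod_cast hm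
    push_cast
    linear_combination hm'
  rw [this]
  exact Nat.cast_ne_zero.2 (Nat.succ_ne_zero _)

theorem isUnit_det_shiftCoeff (ha : 0 < a) (lam n : ℕ) : IsUnit (shiftCoeff N a lam n).det := by
  have h := congrArg Matrix.det (shiftCoeff_mul_baseChange (N := N) ha lam n)
  rw [Matrix.det_mul, Matrix.det_mul, Matrix.det_smul] at h
  refine isUnit_of_mul_isUnit_left (y := (baseChange N a (n + lam)).det) ?_
  rw [h]
  exact (isUnit_det_baseChange ha _).mul
    ((isUnit_iff_ne_zero.2 (by norm_num)).mul (isUnit_det_sub_Jdiag lam))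

theorem isUnit_det_Dch (ha : 0 < a) (n lam : ℕ) : IsUnit (Dch N a n lam).det := by
  rw [Dch_eq, Matrix.det_diagonal, isUnit_iff_ne_zero, Finset.prod_ne_zero_iff]
  intro j _
  have ha' : (a : ℂ) ≠ 0 := by exact_mod_cast ha.ne'
  have h (k : ℕ) : (k.factorial : ℂ) ≠ 0 := by exact_mod_cast Nat.factorial_ne_zero _
  have h2 : ((a : ℂ) / 2) ≠ 0 := div_ne_zero ha' two_ne_zero
  simp [h, ha', Complex.exp_ne_zero]

theorem sub_Jdiag_mul_Dch (n lam : ℕ) :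
    (((N : ℂ) + lam + 1) • (1 : Mat N) - Jdiag N) * Dch N a (n + 1) lam
      = (2 * ((n : ℂ) + 1)) • Dch N a n (lam + 1) := by
  rw [sub_Jdiag_eq_diagonal, Dch_eq, Dch_eq, Matrix.diagonal_mul_diagonal,
    ← Matrix.diagonal_smul]
  congr 1
  ext j
  obtain ⟨m, hm⟩ := Nat.exists_eq_add_of_lt j.isLt
  have h (k : ℕ) : (k.factorial : ℂ) ≠ 0 := by exact_mod_cast Nat.factorial_ne_zero _
  have h1 : (N : ℂ) + lam + 1 - ((j : ℂ) + 1) = (lam : ℂ) + m + 1 := by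
    have hm' : (N : ℂ) = (j : ℕ) + m + 1 := by exact_mod_cast hm
    linear_combination hm'
  rw [h1, Pi.smul_apply, show lam + (N - ((j : ℕ) + 1)) = lam + m by omega,
    show lam + 1 + (N - ((j : ℕ) + 1)) = lam + m + 1 by omega,
    show N + (lam + 1) + n = N + lam + (n + 1) by omega,
    show lam + 1 + n = lam + (n + 1) by omega, Nat.factorial_succ n, Nat.factorial_succ (lam + m)]
  push_cast
  simp only [smul_eq_mul]
  ring

variable {P : ℕ → ℕ → Polynomial (Mat N)}

theorem shiftCoeff_mul_ip (ha : 0 < a)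
    (hP : ∀ lam : ℕ, IsMOSN (Wch N a (μch N a) (δch a lam) lam) (P lam)) (lam n : ℕ) :
    shiftCoeff N a lam (n + 1) * ip (Wch N a (μch N a) (δch a lam) lam)
        (matEval (P lam (n + 1))) (matEval (P lam (n + 1)))
      = (-((n : ℂ) + 1)) • ip (Wch N a (μch N a) (δch a (lam + 1)) (lam + 1))
        (matEval (P (lam + 1) n)) (matEval (P (lam + 1) n)) := by
  have h1 := shiftOp_sub_mem ha lam ((hP (lam + 1)).sub_monomial_mem n)
  rw [one_mul] at h1
  have h2 := (hP (lam + 1)).ip_of_sub_mem' (isWeight_Wch ..)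
    (difference_sub_mem_degLT ((hP lam).sub_monomial_mem (n + 1)))
  rw [← (hP lam).ip_of_sub_mem (isWeight_Wch ..) h1, ip_shiftOp_left ha lam
    ((hP (lam + 1)).mem_degLT n) ((hP lam).mem_degLT (n + 1)), h2, neg_smul]
  simp

theorem ip_self_zero (ha : 0 < a) {P : ℕ → Polynomial (Mat N)} (lam : ℕ)
    (hP : IsMOSN (Wch N a (μch N a) (δch a lam) lam) P) :
    ip (Wch N a (μch N a) (δch a lam) lam) (matEval (P 0)) (matEval (P 0))
      = baseChange N a lam * Dch N a 0 lam * (baseChange N a lam)ᴴ := by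
  have h0 : P 0 = 1 := Polynomial.eq_one_of_monic_natDegree_zero (hP.monic 0) (hP.deg 0)
  have hL := isUnit_det_Lmat_zero (N := N) ha
  have h := Lmat_mul_tsum_Wch_mul (N := N) ha lam
  simp only [ip, h0, matEval, Polynomial.eval_one, Matrix.conjTranspose_one, mul_one, one_mul]
  have h1 : ((Lmat N a (μch N a) 0)ᴴ) * ((Lmat N a (μch N a) 0)⁻¹)ᴴ = 1 := by
    rw [← Matrix.conjTranspose_mul, Matrix.nonsing_inv_mul _ hL, Matrix.conjTranspose_one]
  calc _ = (Lmat N a (μch N a) 0)⁻¹ * (Lmat N a (μch N a) 0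
          * (∑' x, Wch N a (μch N a) (δch a lam) lam x) * (Lmat N a (μch N a) 0)ᴴ)
          * ((Lmat N a (μch N a) 0)⁻¹)ᴴ := by
        rw [Matrix.mul_assoc _ _ ((Lmat N a (μch N a) 0)⁻¹)ᴴ, Matrix.mul_assoc _ _
          ((Lmat N a (μch N a) 0)⁻¹)ᴴ, h1, Matrix.mul_one, ← Matrix.mul_assoc,
          Matrix.nonsing_inv_mul _ hL, Matrix.one_mul]
    _ = _ := by
        rw [h, baseChange, Matrix.conjTranspose_mul]
        simp only [Matrix.mul_assoc]

theorem ip_self_eq (ha : 0 < a)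
    (hP : ∀ lam : ℕ, IsMOSN (Wch N a (μch N a) (δch a lam) lam) (P lam)) (lam n : ℕ) :
    ip (Wch N a (μch N a) (δch a lam) lam) (matEval (P lam n)) (matEval (P lam n))
      = baseChange N a (n + lam) * Dch N a n lam * (baseChange N a (n + lam))ᴴ := by
  induction n generalizing lam with
  | zero => rw [zero_add, ip_self_zero ha lam (hP lam)]
  | succ n ih =>
    have hK := isUnit_det_shiftCoeff (N := N) ha lam (n + 1)
    refine ((Matrix.isUnit_iff_isUnit_det _).2 hK).mul_left_cancel ?_
    rw [shiftCoeff_mul_ip ha hP, ih, ← Matrix.mul_assoc, ← Matrix.mul_assoc,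
      shiftCoeff_mul_baseChange ha, Matrix.mul_assoc _ _ (Dch N a (n + 1) lam), smul_mul_assoc,
      sub_Jdiag_mul_Dch, show n + 1 + lam = n + (lam + 1) by omega]
    simp only [mul_smul_comm, smul_mul_assoc, smul_smul]
    congr 1
    ring

end SquaredNorm

namespace IsMOSN

variable {N : ℕ} {W : ℕ → Mat N} {P : ℕ → Polynomial (Mat N)}

theorem recurrence_lower_mul (hP : IsMOSN W P) (hW : IsWeight W) {n : ℕ} {B C : Mat N}
    (h : ∀ z : ℂ, z • matEval (P (n + 1)) z
      = matEval (P (n + 2)) z + B * matEval (P (n + 1)) z + C * matEval (P n) z) :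
    C * ip W (matEval (P n)) (matEval (P n))
      = ip W (matEval (P (n + 1))) (matEval (P (n + 1))) := by
  have h2 := const_mul_mem_degLT (hP.mem_degLT (n + 1)) B
  have h0 := const_mul_mem_degLT (hP.mem_degLT n) C
  have hz : ((fun z => z • matEval (P n) z) - fun z => z ^ (n + 1) • (1 : Mat N))
      ∈ degLT N (n + 1) := by
    convert smul_mem_degLT (hP.sub_monomial_mem n) using 1
    ext1 z
    simp [smul_sub, smul_smul, pow_succ']
  have e : (fun z => z • matEval (P (n + 1)) z) = matEval (P (n + 2))
      + (fun z => B * matEval (P (n + 1)) z) + fun z => C * matEval (P n) z := funext h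
  have l : ip W (fun z => z • matEval (P (n + 1)) z) (matEval (P n))
      = C * ip W (matEval (P n)) (matEval (P n)) := by
    rw [e, hW.ip_add_left (add_mem (hP.mem_degLT (n + 2)) (degLT_mono (by omega) h2)) h0
        (hP.mem_degLT n), hW.ip_add_left (hP.mem_degLT (n + 2)) h2 (hP.mem_degLT n),
      hW.ip_mul_left (hP.mem_degLT (n + 1)) (hP.mem_degLT n), hW.ip_mul_left (hP.mem_degLT n)
        (hP.mem_degLT n), hP.ip_eq_zero_of_ne (by omega), hP.ip_eq_zero_of_ne (by omega), mul_zero,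
      add_zero, zero_add]
  have r : ip W (fun z => z • matEval (P (n + 1)) z) (matEval (P n))
      = ip W (matEval (P (n + 1))) (fun z => z • matEval (P n) z) :=
    tsum_congr fun x => by simp [Matrix.conjTranspose_smul]
  rw [← l, r, hP.ip_of_sub_mem' hW hz, Matrix.conjTranspose_one, mul_one]

theorem recurrence_diagonal_eq (hP : IsMOSN W P) (hW : IsWeight W) {n : ℕ} {B C : Mat N}
    (hH : IsUnit (ip W (matEval (P (n + 1))) (matEval (P (n + 1)))))
    (h : ∀ z : ℂ, z • matEval (P (n + 1)) z
      = matEval (P (n + 2)) z + B * matEval (P (n + 1)) z + C * matEval (P n) z) :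
    B = (P (n + 1)).coeff n - (P (n + 2)).coeff (n + 1) := by
  have hB := const_mul_mem_degLT (hP.mem_degLT (n + 1)) B
  have hC := const_mul_mem_degLT (hP.mem_degLT n) C
  have e : (fun z => z • matEval (P (n + 1)) z) - matEval (P (n + 2))
      = (fun z => B * matEval (P (n + 1)) z) + fun z => C * matEval (P n) z := by
    ext1 z
    simp only [Pi.sub_apply, Pi.add_apply, h]
    abel
  have hf : ((fun z => z • matEval (P (n + 1)) z) - matEval (P (n + 2)) - fun z =>
      z ^ (n + 1) • ((P (n + 1)).coeff n - (P (n + 2)).coeff (n + 1))) ∈ degLT N (n + 1) := by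
    convert sub_mem (smul_mem_degLT (matEval_sub_sub_mem_degLT (hP.monic (n + 1))
      (hP.deg (n + 1)))) (matEval_sub_sub_mem_degLT (hP.monic (n + 2)) (hP.deg (n + 2))) using 1
    ext1 z
    simp only [Pi.sub_apply, smul_sub, smul_smul, ← pow_succ']
    abel
  have h1 := hP.ip_of_sub_mem hW hf
  rw [e, hW.ip_add_left hB hC (hP.mem_degLT (n + 1)), hW.ip_mul_left (hP.mem_degLT (n + 1))
      (hP.mem_degLT (n + 1)), hW.ip_mul_left (hP.mem_degLT n) (hP.mem_degLT (n + 1)),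
    hP.ip_eq_zero_of_ne n.lt_succ_self.ne, mul_zero, add_zero] at h1
  exact hH.mul_right_cancel h1

end IsMOSN

section SubleadingCoefficient

variable {N : ℕ} {a : ℝ} {P : ℕ → ℕ → Polynomial (Mat N)}

theorem isUnit_ip_self (ha : 0 < a)
    (hP : ∀ lam : ℕ, IsMOSN (Wch N a (μch N a) (δch a lam) lam) (P lam)) (lam n : ℕ) :
    IsUnit (ip (Wch N a (μch N a) (δch a lam) lam) (matEval (P lam n)) (matEval (P lam n))) := by
  have hE := isUnit_det_baseChange (N := N) ha (n + lam)
  rw [ip_self_eq ha hP, Matrix.isUnit_iff_isUnit_det, Matrix.det_mul, Matrix.det_mul,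
    Matrix.det_conjTranspose]
  exact (hE.mul (isUnit_det_Dch ha n lam)).mul hE.star

theorem difference_sub_sub_mem_degLT {n : ℕ} {f : ℂ → Mat N} {c : Mat N}
    (hf : (f - (fun z => z ^ (n + 2) • (1 : Mat N)) - fun z => z ^ (n + 1) • c)
      ∈ degLT N (n + 1)) :
    ((fun z => f (z + 1) - f z) - (fun z => z ^ (n + 1) • ((n : ℂ) + 2) • (1 : Mat N))
      - fun z => z ^ n • ((((n : ℂ) + 2) * (n + 1) / 2) • (1 : Mat N) + ((n : ℂ) + 1) • c))
      ∈ degLT N n := by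
  convert add_mem (add_mem (difference_mem_degLT hf 1)
    (monomial_difference_sub_sub_mem_degLT n (1 : Mat N)))
    (monomial_difference_sub_mem_degLT n 1 c) using 1
  ext1 z
  simp only [Pi.sub_apply, Pi.add_apply, mul_one, smul_add]
  abel

theorem coeff_succ_relation (ha : 0 < a)
    (hP : ∀ lam : ℕ, IsMOSN (Wch N a (μch N a) (δch a lam) lam) (P lam)) (lam n : ℕ) :
    ((n : ℂ) + 1) • (P lam (n + 2)).coeff (n + 1)
      = ((n : ℂ) + 2) • (P (lam + 1) (n + 1)).coeff n
        - (((n : ℂ) + 2) * (n + 1) / 2) • (1 : Mat N) := by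
  have hW := isWeight_Wch N a (μch N a) (δch a (lam + 1)) (lam + 1)
  have hQ := hP (lam + 1)
  have hΔ : (fun z => matEval (P lam (n + 2)) (z + 1) - matEval (P lam (n + 2)) z)
      ∈ degLT N (n + 2) := difference_mem_degLT ((hP lam).mem_degLT (n + 2)) 1
  have hM := const_mul_mem_degLT (hQ.mem_degLT (n + 1)) (((n : ℂ) + 2) • (1 : Mat N))
  have hf : ((fun z => matEval (P lam (n + 2)) (z + 1) - matEval (P lam (n + 2)) z)
      - (fun z => (((n : ℂ) + 2) • (1 : Mat N)) * matEval (P (lam + 1) (n + 1)) z)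
      - fun z => z ^ n • ((((n : ℂ) + 2) * (n + 1) / 2) • (1 : Mat N)
        + ((n : ℂ) + 1) • (P lam (n + 2)).coeff (n + 1)
        - ((n : ℂ) + 2) • (P (lam + 1) (n + 1)).coeff n)) ∈ degLT N n := by
    convert sub_mem (difference_sub_sub_mem_degLT (matEval_sub_sub_mem_degLT
        ((hP lam).monic (n + 2)) ((hP lam).deg (n + 2))))
      (const_mul_mem_degLT (matEval_sub_sub_mem_degLT (hQ.monic (n + 1)) (hQ.deg (n + 1)))
        (((n : ℂ) + 2) • (1 : Mat N))) using 1
    ext1 z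
    simp only [Pi.sub_apply, smul_sub, mul_sub, smul_mul_assoc, one_mul,
      smul_comm ((n : ℂ) + 2) (z ^ _)]
    abel
  have h := hQ.ip_of_sub_mem hW hf
  have h0 : ip (Wch N a (μch N a) (δch a (lam + 1)) (lam + 1))
      (fun z => matEval (P lam (n + 2)) (z + 1) - matEval (P lam (n + 2)) z)
      (matEval (P (lam + 1) n)) = 0 := by
    rw [← neg_eq_zero, ← ip_shiftOp_right ha lam (hQ.mem_degLT n) ((hP lam).mem_degLT (n + 2)),
      (hP lam).ip_eq_zero_of_mem' (isWeight_Wch ..)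
        (shiftOp_mem_degLT (a := a) lam (hQ.mem_degLT n))]
  rw [hW.ip_sub_left hΔ hM (hQ.mem_degLT n), h0, hW.ip_mul_left (hQ.mem_degLT (n + 1))
    (hQ.mem_degLT n), hQ.ip_eq_zero_of_ne (by omega), mul_zero, sub_zero] at h
  have h1 := (isUnit_ip_self ha hP (lam + 1) n).mul_right_cancel (h.symm.trans (zero_mul _).symm)
  rw [← sub_eq_zero, ← h1]
  abel

theorem coeff_succ_eq (ha : 0 < a)
    (hP : ∀ lam : ℕ, IsMOSN (Wch N a (μch N a) (δch a lam) lam) (P lam)) (lam n : ℕ) :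
    (P lam (n + 1)).coeff n = ((n : ℂ) + 1) • (P (n + lam) 1).coeff 0
      - ((n : ℂ) * (n + 1) / 2) • (1 : Mat N) := by
  induction n generalizing lam with
  | zero => simp
  | succ n ih =>
    have hn : (n : ℂ) + 1 ≠ 0 := Nat.cast_add_one_ne_zero n
    apply smul_right_injective _ hn
    dsimp only
    rw [coeff_succ_relation ha hP, ih, show n + 1 + lam = n + (lam + 1) by omega]
    push_cast
    module

theorem shiftCoeff_mul_coeff_zero (ha : 0 < a)
    (hP : ∀ lam : ℕ, IsMOSN (Wch N a (μch N a) (δch a lam) lam) (P lam)) (lam : ℕ) :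
    shiftCoeff N a lam 1 * (P lam 1).coeff 0 = Psi N a lam 0 := by
  have hW := isWeight_Wch N a (μch N a) (δch a lam) lam
  have hQ := hP lam
  have h1 : ((fun _ => 1 : ℂ → Mat N) - fun z => z ^ 0 • (1 : Mat N)) ∈ degLT N 0 := by
    simp
  have hs := shiftOp_sub_mem ha lam h1
  rw [one_mul] at hs
  obtain ⟨c, hc⟩ := exists_of_mem_degLT_succ (hQ.sub_mul_mem hs)
  have h0 : ip (Wch N a (μch N a) (δch a lam) lam) (shiftOp N a lam fun _ => 1)
      (matEval (P lam 0)) = 0 := by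
    have hQ0 : P lam 0 = 1 :=
      Polynomial.eq_one_of_monic_natDegree_zero (hQ.monic 0) (hQ.deg 0)
    rw [ip_shiftOp_left ha lam (const_mem_degLT 1) (hQ.mem_degLT 0)]
    simp [hQ0, matEval, ip]
  have hc0 : c = 0 := by
    have h := hQ.ip_of_sub_mem hW hc
    rw [hW.ip_sub_left (shiftOp_mem_degLT (a := a) lam (const_mem_degLT 1))
      (const_mul_mem_degLT (hQ.mem_degLT 1) _) (hQ.mem_degLT 0), h0,
      hW.ip_mul_left (hQ.mem_degLT 1) (hQ.mem_degLT 0), hQ.ip_eq_zero_of_ne one_ne_zero, mul_zero,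
      sub_zero] at h
    exact (isUnit_ip_self ha hP lam 0).mul_right_cancel (h.symm.trans (zero_mul _).symm)
  obtain ⟨d, hd⟩ := hc
  have hv := hd 0
  simp [hc0, shiftOp, Omega, matEval, Polynomial.coeff_zero_eq_eval_zero] at hv ⊢
  exact (sub_eq_zero.1 hv).symm

theorem Lmat_inv_mul_sub_Jdiag_add_Fmat (ha : 0 < a) (c : ℂ) :
    (Lmat N a (μch N a) 0)⁻¹ * (((N : ℂ) + c + 1) • (1 : Mat N) - Jdiag N + Fmat N a)
      = (c • (1 : Mat N) + Jdiag N + Fmat N a) * (Lmat N a (μch N a) 0)⁻¹ := by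
  have ha' : (a : ℂ) ≠ 0 := by exact_mod_cast ha.ne'
  refine nonsing_inv_mul_of_mul_eq (isUnit_det_Lmat_zero ha) ?_
  rw [mul_add, mul_add, Lmat_mul_Jdiag ha, Lmat_mul_Fmat ha, mul_smul_comm, mul_one,
    show c • Lmat N a (μch N a) 0 = (c • (1 : Mat N)) * Lmat N a (μch N a) 0 by
      rw [smul_mul_assoc, one_mul], ← add_mul, ← add_mul, Smat, smul_smul,
    mul_one_div_cancel ha']
  congr 1
  module

theorem Acal_eq (ν : ℕ) : Acal N a ν = (((N : ℂ) + ν) • (1 : Mat N) - Jdiag N)⁻¹ * Fmat N a :=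
  rfl

theorem sub_Jdiag_mul_Acal (ν : ℕ) :
    (((N : ℂ) + ν + 1) • (1 : Mat N) - Jdiag N) * Acal N a (ν + 1) = Fmat N a := by
  rw [Acal_eq, Nat.cast_succ, ← add_assoc, ← Matrix.mul_assoc,
    Matrix.mul_nonsing_inv _ (isUnit_det_sub_Jdiag ν), one_mul]

theorem Psi_zero_mul_baseChange (ha : 0 < a) (lam : ℕ) :
    Psi N a lam 0 * baseChange N a (lam + 1)
      = ((a : ℂ) / 2) • (baseChange N a (lam + 1)
        * (((N : ℂ) + lam + 1) • (1 : Mat N) - Jdiag N + Fmat N a)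
        * (1 + Amat N (μch N a))) := by
  have hΨ := one_add_pow_mul_Psi (N := N) ha lam 0
  rw [Nat.cast_zero, zero_add] at hΨ
  have hL : (Lmat N a (μch N a) 0)⁻¹ * (1 + Amat N (μch N a))
      = (1 + Amat N (μch N a)) * (Lmat N a (μch N a) 0)⁻¹ := by
    rw [mul_add, add_mul, Lmat_inv_mul_Amat ha, one_mul, mul_one]
  have hE (ν : ℕ) : baseChange N a ν = (1 + Amat N (μch N a)) ^ ν * (Lmat N a (μch N a) 0)⁻¹ :=
    (show Commute _ _ from hL).pow_right ν
  calc Psi N a lam 0 * baseChange N a (lam + 1)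
      = Psi N a lam 0 * (1 + Amat N (μch N a)) ^ lam
          * ((1 + Amat N (μch N a)) * (Lmat N a (μch N a) 0)⁻¹) := by
        rw [hE, pow_succ]
        simp only [Matrix.mul_assoc]
    _ = _ := by
        rw [hΨ, ← hL, hE, Matrix.mul_assoc (_ ^ (lam + 1)) _ (_ - _ + _),
          Lmat_inv_mul_sub_Jdiag_add_Fmat ha, pow_succ]
        simp only [mul_smul_comm, smul_mul_assoc, Matrix.mul_assoc]

theorem coeff_zero_mul_baseChange (ha : 0 < a)
    (hP : ∀ lam : ℕ, IsMOSN (Wch N a (μch N a) (δch a lam) lam) (P lam)) (lam : ℕ) :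
    (P lam 1).coeff 0 * baseChange N a (lam + 1)
      = (-(a : ℂ)) • (baseChange N a (lam + 1)
        * ((Acal N a (lam + 1) + 1) * (1 + Amat N (μch N a)))) := by
  have hK := isUnit_det_shiftCoeff (N := N) ha lam 1
  have hS := shiftCoeff_mul_baseChange (N := N) ha lam 1
  rw [add_comm 1 lam] at hS
  have hF : (((N : ℂ) + lam + 1) • (1 : Mat N) - Jdiag N) * (Acal N a (lam + 1) + 1)
      = ((N : ℂ) + lam + 1) • (1 : Mat N) - Jdiag N + Fmat N a := by
    rw [mul_add, sub_Jdiag_mul_Acal, mul_one, add_comm]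
  refine ((Matrix.isUnit_iff_isUnit_det _).2 hK).mul_left_cancel ?_
  rw [← Matrix.mul_assoc, shiftCoeff_mul_coeff_zero ha hP, Psi_zero_mul_baseChange ha,
    mul_smul_comm, ← Matrix.mul_assoc, hS,
    ← hF]
  simp only [smul_mul_assoc, mul_smul_comm, smul_smul, Matrix.mul_assoc]
  congr 1
  ring

theorem coeff_zero_mul_baseChange' (ha : 0 < a)
    (hP : ∀ lam : ℕ, IsMOSN (Wch N a (μch N a) (δch a lam) lam) (P lam)) (lam : ℕ) :
    (P lam 1).coeff 0 * baseChange N a lam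
      = (-(a : ℂ)) • (baseChange N a lam
        * ((1 + Amat N (μch N a)) * (Acal N a (lam + 1) + 1))) := by
  have hV := isUnit_det_one_add_Amat (N := N) (μch N a)
  refine ((Matrix.isUnit_iff_isUnit_det _).2 hV).mul_right_cancel ?_
  have h := coeff_zero_mul_baseChange ha hP lam
  rw [baseChange_succ, ← Matrix.mul_assoc] at h
  rw [h, smul_mul_assoc]
  simp only [Matrix.mul_assoc]

end SubleadingCoefficient

theorem eq_of_mul_congruence {N : ℕ} {M E V D D' : Mat N} (hE : IsUnit E.det) (hD : IsUnit D.det)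
    (h : M * (E * D * Eᴴ) = E * V * D' * (E * V)ᴴ) : M = E * V * D' * Vᴴ * D⁻¹ * E⁻¹ := by
  have hE' : IsUnit (Eᴴ).det := by
    rw [Matrix.det_conjTranspose]
    exact hE.star
  have hM : M * E * D = E * V * D' * Vᴴ := by
    rw [← Matrix.mul_nonsing_inv_cancel_right (B := M * E * D) _ hE',
      ← Matrix.mul_nonsing_inv_cancel_right (B := E * V * D' * Vᴴ) _ hE']
    congr 1
    simpa only [Matrix.conjTranspose_mul, Matrix.mul_assoc] using h
  rw [← hM, Matrix.mul_nonsing_inv_cancel_right _ _ hD, Matrix.mul_nonsing_inv_cancel_right _ _ hE]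

/-- explicit formulas for the three term recurrence coefficients
`B_n^{(λ)}` and `C_n^{(λ)}` of the monic matrix Charlier polynomials. -/
theorem charlier_recurrence_coefficients (N : ℕ) (hN : 1 ≤ N) (a : ℝ) (ha : 0 < a)
    (P : ℕ → ℕ → Polynomial (Mat N))
    (hP : ∀ lam : ℕ, IsMOSN (Wch N a (μch N a) (δch a lam) lam) (P lam))
    (B C : ℕ → ℕ → Mat N)
    (hrec : ∀ lam n : ℕ, ∀ z : ℂ, z • matEval (P lam n) z
      = matEval (P lam (n + 1)) z + B lam n * matEval (P lam n) z
          + (if n = 0 then 0 else C lam n * matEval (P lam (n - 1)) z)) :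
    ∀ lam : ℕ, ∀ n : ℕ, 1 ≤ n →
      C lam n = (Lmat N a (μch N a) 0)⁻¹ * (1 + Amat N (μch N a)) ^ (n + lam)
          * Dch N a n lam * (1 + (Amat N (μch N a))ᴴ) * (Dch N a (n - 1) lam)⁻¹
          * ((1 + Amat N (μch N a)) ^ (n + lam - 1))⁻¹ * Lmat N a (μch N a) 0 ∧
      B lam n = (a : ℂ) • ((Lmat N a (μch N a) 0)⁻¹ * (1 + Amat N (μch N a)) ^ (n + lam)
          * (((n : ℂ) + 1) • ((1 + Amat N (μch N a)) * Acal N a (n + lam + 1))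
              - (n : ℂ) • (Acal N a (n + lam) * (1 + Amat N (μch N a)))
              + (1 + Amat N (μch N a)) + ((n : ℂ) / (a : ℂ)) • (1 : Mat N))
          * ((1 + Amat N (μch N a)) ^ (n + lam))⁻¹ * Lmat N a (μch N a) 0) := by
  intro lam n hn
  obtain ⟨n, rfl⟩ := Nat.exists_eq_add_of_le' hn
  have hrec' : ∀ z : ℂ, z • matEval (P lam (n + 1)) z = matEval (P lam (n + 2)) z
      + B lam (n + 1) * matEval (P lam (n + 1)) z + C lam (n + 1) * matEval (P lam n) z :=
    fun z => by simpa using hrec lam (n + 1) z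
  have hW := isWeight_Wch N a (μch N a) (δch a lam) lam
  have hE (ν : ℕ) := isUnit_det_baseChange (N := N) ha ν
  have hinv (ν : ℕ) : (baseChange N a ν)⁻¹
      = ((1 + Amat N (μch N a)) ^ ν)⁻¹ * Lmat N a (μch N a) 0 := by
    rw [baseChange, Matrix.mul_inv_rev, Matrix.nonsing_inv_nonsing_inv _ (isUnit_det_Lmat_zero ha)]
  constructor
  · have h := (hP lam).recurrence_lower_mul hW hrec'
    rw [ip_self_eq ha hP, ip_self_eq ha hP, show n + 1 + lam = n + lam + 1 by omega,
      baseChange_succ] at h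
    have hC := eq_of_mul_congruence (hE _) (isUnit_det_Dch ha n lam) h
    rw [hC, hinv, ← baseChange_succ, baseChange, Matrix.conjTranspose_add,
      Matrix.conjTranspose_one, show n + 1 + lam - 1 = n + lam by omega,
      show n + 1 + lam = n + lam + 1 by omega, Nat.add_sub_cancel, ← Matrix.mul_assoc]
  · have h := (hP lam).recurrence_diagonal_eq hW (isUnit_ip_self ha hP lam (n + 1)) hrec'
    rw [coeff_succ_eq ha hP lam n, coeff_succ_eq ha hP lam (n + 1)] at h
    have h1 := coeff_zero_mul_baseChange ha hP (n + lam)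
    have h2 := coeff_zero_mul_baseChange' ha hP (n + 1 + lam)
    have ha' : (a : ℂ) ≠ 0 := by exact_mod_cast ha.ne'
    rw [show n + lam + 1 = n + 1 + lam by omega] at h1
    have hM : B lam (n + 1) * baseChange N a (n + 1 + lam) = (a : ℂ) • (baseChange N a (n + 1 + lam)
        * ((((n + 1 : ℕ) : ℂ) + 1) • ((1 + Amat N (μch N a)) * Acal N a (n + 1 + lam + 1))
          - ((n + 1 : ℕ) : ℂ) • (Acal N a (n + 1 + lam) * (1 + Amat N (μch N a)))
          + (1 + Amat N (μch N a)) + (((n + 1 : ℕ) : ℂ) / (a : ℂ)) • (1 : Mat N))) := by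
      simp only [h, sub_mul, smul_mul_assoc, one_mul, h1, h2, mul_add, mul_sub, add_mul, mul_one,
        mul_smul_comm]
      push_cast
      match_scalars <;> field_simp <;> ring
    rw [← Matrix.mul_nonsing_inv_cancel_right (B := B lam (n + 1)) _ (hE (n + 1 + lam)), hM, hinv,
      baseChange]
    simp only [smul_mul_assoc, Matrix.mul_assoc]
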